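/- arXiv:2601.17501 — 12 statements merged into one kernel-verified Lean document; each statement's English description precedes it below -/
import Mathlib

section
/- If r is monotone nondecreasing on a subinterval (a,b) ⊆ (0,1), then δ is monotone nondecreasing on (a,b); and if r is monotone nonincreasing on a subinterval (a,b) ⊆ (0,1), then δ is monotone nonincreasing on (a,b). (Key monotonicity property of δ established in the proof of Theorem 2.0.) -/
open Set Filter Topology MeasureTheory intervalIntegral

/-- A function on `(0, 1)` with positive derivative and nonnegative limit at `0⁺` is nonnegative. -/
theorem nonneg_of_hasDerivAt_pos_of_tendsto {f f' : ℝ → ℝ} {l : ℝ}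
    (hf : ∀ p ∈ Ioo (0:ℝ) 1, HasDerivAt f (f' p) p) (hf' : ∀ p ∈ Ioo (0:ℝ) 1, 0 < f' p)
    (hl : Tendsto f (𝓝[>] (0:ℝ)) (𝓝 l)) (hl0 : 0 ≤ l) {p : ℝ} (hp : p ∈ Ioo (0:ℝ) 1) :
    0 ≤ f p := by
  have hmono : StrictMonoOn f (Ioo 0 1) :=
    strictMonoOn_of_hasDerivWithinAt_pos (f' := f') (convex_Ioo 0 1)
      (fun x hx => (hf x hx).continuousAt.continuousWithinAt)
      (fun x hx => (hf x (interior_subset hx)).hasDerivWithinAt)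
      (fun x hx => hf' x (interior_subset hx))
  refine hl0.trans (le_of_tendsto hl ?_)
  filter_upwards [Ioo_mem_nhdsGT hp.1] with x hx
  exact (hmono ⟨hx.1, hx.2.trans hp.2⟩ hp hx.2).le

/-- Cauchy's mean value theorem in quotient form, for a denominator with positive derivative. -/
theorem exists_sub_eq_div_mul_sub {f f' g g' : ℝ → ℝ} {p q : ℝ} (hpq : p < q)
    (hf : ∀ x ∈ Icc p q, HasDerivAt f (f' x) x) (hg : ∀ x ∈ Icc p q, HasDerivAt g (g' x) x)
    (hf' : ∀ x ∈ Icc p q, 0 < f' x) :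
    f p < f q ∧ ∃ c ∈ Ioo p q, g q - g p = g' c / f' c * (f q - f p) := by
  have hfc : ContinuousOn f (Icc p q) := fun x hx => (hf x hx).continuousAt.continuousWithinAt
  have hgc : ContinuousOn g (Icc p q) := fun x hx => (hg x hx).continuousAt.continuousWithinAt
  have hmono : StrictMonoOn f (Icc p q) :=
    strictMonoOn_of_hasDerivWithinAt_pos (f' := f') (convex_Icc p q) hfc
      (fun x hx => (hf x (interior_subset hx)).hasDerivWithinAt)
      (fun x hx => hf' x (interior_subset hx))
  refine ⟨hmono (left_mem_Icc.2 hpq.le) (right_mem_Icc.2 hpq.le) hpq, ?_⟩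
  obtain ⟨c, hc, h⟩ := exists_ratio_hasDerivAt_eq_ratio_slope f f' hpq hfc
    (fun x hx => hf x (Ioo_subset_Icc_self hx)) g g' hgc
    (fun x hx => hg x (Ioo_subset_Icc_self hx))
  refine ⟨c, hc, ?_⟩
  have hne := (hf' c (Ioo_subset_Icc_self hc)).ne'
  field_simp
  linarith

theorem stmt0
    (φ ψ φ' ψ' r δ : ℝ → ℝ)
    (hφd : ∀ p ∈ Ioo (0:ℝ) 1, HasDerivAt φ (φ' p) p)
    (hψd : ∀ p ∈ Ioo (0:ℝ) 1, HasDerivAt ψ (ψ' p) p)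
    (hφ'pos : ∀ p ∈ Ioo (0:ℝ) 1, 0 < φ' p)
    (hψ'pos : ∀ p ∈ Ioo (0:ℝ) 1, 0 < ψ' p)
    (hr : ∀ p ∈ Ioo (0:ℝ) 1, r p = ψ' p / φ' p)
    (hrc : ContinuousOn r (Ioo 0 1))
    (lX lY : ℝ)
    (hlX : Tendsto φ (𝓝[>] (0:ℝ)) (𝓝 lX))
    (hlY : Tendsto ψ (𝓝[>] (0:ℝ)) (𝓝 lY))
    (hlX0 : 0 ≤ lX) (hlY0 : 0 ≤ lY)
    (hδ : ∀ p ∈ Ioo (0:ℝ) 1, δ p = φ p * r p - ψ p)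
    (a b : ℝ) (hab : a < b) (hsub : Ioo a b ⊆ Ioo (0:ℝ) 1) :
    (MonotoneOn r (Ioo a b) → MonotoneOn δ (Ioo a b)) ∧
    (AntitoneOn r (Ioo a b) → AntitoneOn δ (Ioo a b)) := by
  have key : ∀ p ∈ Ioo a b, ∀ q ∈ Ioo a b, p < q →
      0 ≤ φ p ∧ φ p < φ q ∧ ∃ c ∈ Ioo p q, ψ q - ψ p = r c * (φ q - φ p) := by
    intro p hp q hq hpq
    have hIcc : Icc p q ⊆ Ioo 0 1 := (Icc_subset_Ioo hp.1 hq.2).trans hsub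
    obtain ⟨hlt, c, hc, h⟩ := exists_sub_eq_div_mul_sub hpq
      (fun x hx => hφd x (hIcc hx)) (fun x hx => hψd x (hIcc hx)) (fun x hx => hφ'pos x (hIcc hx))
    refine ⟨nonneg_of_hasDerivAt_pos_of_tendsto hφd hφ'pos hlX hlX0 (hsub hp), hlt, c, hc, ?_⟩
    rw [hr c (hIcc (Ioo_subset_Icc_self hc)), h]
  constructor
  · intro hmono p hp q hq hpq
    rcases hpq.eq_or_lt with rfl | hlt
    · exact le_rfl
    obtain ⟨h0, hφ, c, hc, h⟩ := key p hp q hq hlt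
    have hcq : r c ≤ r q := hmono ⟨hp.1.trans hc.1, hc.2.trans hq.2⟩ hq hc.2.le
    have hrpq : r p ≤ r q := hmono hp hq hpq
    rw [hδ p (hsub hp), hδ q (hsub hq)]
    nlinarith [mul_le_mul_of_nonneg_right hcq (sub_nonneg.2 hφ.le),
      mul_le_mul_of_nonneg_left hrpq h0]
  · intro hanti p hp q hq hpq
    rcases hpq.eq_or_lt with rfl | hlt
    · exact le_rfl
    obtain ⟨h0, hφ, c, hc, h⟩ := key p hp q hq hlt
    have hcq : r q ≤ r c := hanti ⟨hp.1.trans hc.1, hc.2.trans hq.2⟩ hq hc.2.le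
    have hrpq : r q ≤ r p := hanti hp hq hpq
    rw [hδ p (hsub hp), hδ q (hsub hq)]
    nlinarith [mul_le_mul_of_nonneg_right hcq (sub_nonneg.2 hφ.le),
      mul_le_mul_of_nonneg_left hrpq h0]
end

section
/- Let 0 < a < b < 1 and suppose r is monotone (either nondecreasing or nonincreasing) on the closed interval [a,b]. Then the ratio p ↦ ψ(p)/φ(p) fails to be monotone on (a,b) — i.e., it is neither nondecreasing on (a,b) nor nonincreasing on (a,b) — if and only if δ(a)·δ(b) < 0. (Per-interval criterion of Theorem 2.0 for the existence of a mode of the ratio of the quantile functions.) -/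
open Set Filter Topology MeasureTheory intervalIntegral

/-- A function whose derivative is a positive multiple of a continuous function `d` is nondecreasing
on an open interval iff `d` is nonnegative on its closure. -/
theorem monotoneOn_Ioo_iff_of_hasDerivAt_mul {g w d : ℝ → ℝ} {a b : ℝ} (hab : a < b)
    (hg : ∀ p ∈ Ioo a b, HasDerivAt g (w p * d p) p) (hw : ∀ p ∈ Ioo a b, 0 < w p)
    (hd : ContinuousOn d (Icc a b)) :
    MonotoneOn g (Ioo a b) ↔ ∀ p ∈ Icc a b, 0 ≤ d p := by
  constructor
  · intro hmono
    have hnonneg : ∀ p ∈ Ioo a b, 0 ≤ d p := by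
      intro p hp
      have h : 0 ≤ derivWithin g (Ioo a b) p := hmono.derivWithin_nonneg
      rw [derivWithin_of_isOpen isOpen_Ioo hp, (hg p hp).deriv] at h
      exact nonneg_of_mul_nonneg_right h (hw p hp)
    intro p hp
    have hcl : closure (Ioo a b) = Icc a b := closure_Ioo hab.ne
    rw [← hcl] at hd hp
    exact le_on_closure hnonneg continuousOn_const hd hp
  · intro h
    refine monotoneOn_of_deriv_nonneg (convex_Ioo a b)
      (fun p hp => (hg p hp).continuousAt.continuousWithinAt) ?_ ?_
    · rw [interior_Ioo]
      exact fun p hp => (hg p hp).differentiableAt.differentiableWithinAt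
    · rw [interior_Ioo]
      intro p hp
      rw [(hg p hp).deriv]
      exact mul_nonneg (hw p hp).le (h p (Ioo_subset_Icc_self hp))

/-- If `r = ψ' / φ'` is nondecreasing, then so is `φ * r - ψ`, provided `φ` is nonnegative and
nondecreasing. -/
theorem monotoneOn_mul_sub_of_hasDerivAt {φ ψ φ' r : ℝ → ℝ} {a b : ℝ}
    (hφ : ∀ p ∈ Icc a b, HasDerivAt φ (φ' p) p)
    (hψ : ∀ p ∈ Icc a b, HasDerivAt ψ (r p * φ' p) p)
    (hφ' : ∀ p ∈ Icc a b, 0 < φ' p) (hφ0 : ∀ p ∈ Icc a b, 0 ≤ φ p)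
    (hr : MonotoneOn r (Icc a b)) :
    MonotoneOn (fun p => φ p * r p - ψ p) (Icc a b) := by
  intro x hx y hy hxy
  rcases hxy.eq_or_lt with rfl | hlt
  · exact le_rfl
  have hsub : Icc x y ⊆ Icc a b := Icc_subset_Icc hx.1 hy.2
  obtain ⟨c, hc, h⟩ := exists_ratio_hasDerivAt_eq_ratio_slope φ φ' hlt
    (fun p hp => (hφ p (hsub hp)).continuousAt.continuousWithinAt)
    (fun p hp => hφ p (hsub (Ioo_subset_Icc_self hp))) ψ (fun p => r p * φ' p)
    (fun p hp => (hψ p (hsub hp)).continuousAt.continuousWithinAt)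
    (fun p hp => hψ p (hsub (Ioo_subset_Icc_self hp)))
  have hcab := hsub (Ioo_subset_Icc_self hc)
  have hdiff : ψ y - ψ x = (φ y - φ x) * r c := by
    refine mul_right_cancel₀ (hφ' c hcab).ne' ?_
    linear_combination h
  have h1 := mul_nonneg (hφ0 x hx) (sub_nonneg.2 (hr hx hcab hc.1.le))
  have h2 := mul_nonneg (hφ0 y hy) (sub_nonneg.2 (hr hcab hy hc.2.le))
  dsimp only
  linarith

theorem stmt1
    (φ ψ φ' ψ' r δ : ℝ → ℝ)
    (hφd : ∀ p ∈ Ioo (0:ℝ) 1, HasDerivAt φ (φ' p) p)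
    (hψd : ∀ p ∈ Ioo (0:ℝ) 1, HasDerivAt ψ (ψ' p) p)
    (hφ'pos : ∀ p ∈ Ioo (0:ℝ) 1, 0 < φ' p)
    (hψ'pos : ∀ p ∈ Ioo (0:ℝ) 1, 0 < ψ' p)
    (hr : ∀ p ∈ Ioo (0:ℝ) 1, r p = ψ' p / φ' p)
    (hrc : ContinuousOn r (Ioo 0 1))
    (lX lY : ℝ)
    (hlX : Tendsto φ (𝓝[>] (0:ℝ)) (𝓝 lX))
    (hlY : Tendsto ψ (𝓝[>] (0:ℝ)) (𝓝 lY))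
    (hlX0 : 0 ≤ lX) (hlY0 : 0 ≤ lY)
    (hδ : ∀ p ∈ Ioo (0:ℝ) 1, δ p = φ p * r p - ψ p)
    (a b : ℝ) (ha : 0 < a) (hab : a < b) (hb : b < 1)
    (hmono : MonotoneOn r (Icc a b) ∨ AntitoneOn r (Icc a b)) :
    (¬ MonotoneOn (fun t => ψ t / φ t) (Ioo a b) ∧ ¬ AntitoneOn (fun t => ψ t / φ t) (Ioo a b)) ↔
      δ a * δ b < 0 := by
  have hIcc : Icc a b ⊆ Ioo (0:ℝ) 1 := fun p hp => ⟨ha.trans_le hp.1, hp.2.trans_lt hb⟩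
  have hφmono : StrictMonoOn φ (Ioo 0 1) := by
    refine strictMonoOn_of_deriv_pos (convex_Ioo 0 1)
      (fun p hp => (hφd p hp).continuousAt.continuousWithinAt) ?_
    rw [interior_Ioo]
    intro p hp
    rw [(hφd p hp).deriv]
    exact hφ'pos p hp
  have hφpos : ∀ p ∈ Ioo (0:ℝ) 1, 0 < φ p := by
    intro p hp
    have hp2 : p / 2 ∈ Ioo (0:ℝ) 1 := ⟨by linarith [hp.1], by linarith [hp.1, hp.2]⟩
    have hle : lX ≤ φ (p / 2) := by
      refine le_of_tendsto hlX ?_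
      filter_upwards [Ioo_mem_nhdsGT hp2.1] with q hq
      exact (hφmono ⟨hq.1, hq.2.trans hp2.2⟩ hp2 hq.2).le
    linarith [hφmono hp2 hp (by linarith [hp.1])]
  have hδc : ContinuousOn δ (Icc a b) := by
    refine ContinuousOn.congr (f := fun p => φ p * r p - ψ p) ?_ fun p hp => hδ p (hIcc hp)
    exact (ContinuousOn.mul (fun p hp => (hφd p (hIcc hp)).continuousAt.continuousWithinAt)
      (hrc.mono hIcc)).sub fun p hp => (hψd p (hIcc hp)).continuousAt.continuousWithinAt
  have hψr : ∀ p ∈ Icc a b, HasDerivAt ψ (r p * φ' p) p := by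
    intro p hp
    rw [hr p (hIcc hp), div_mul_cancel₀ _ (hφ'pos p (hIcc hp)).ne']
    exact hψd p (hIcc hp)
  have hratio : ∀ p ∈ Ioo a b, HasDerivAt (fun t => ψ t / φ t) (φ' p / φ p ^ 2 * δ p) p := by
    intro p hp
    have hp' := Ioo_subset_Icc_self hp
    refine ((hψr p hp').div (hφd p (hIcc hp')) (hφpos p (hIcc hp')).ne').congr_deriv ?_
    rw [hδ p (hIcc hp')]
    ring
  have hw : ∀ p ∈ Ioo a b, 0 < φ' p / φ p ^ 2 := fun p hp =>
    have hp' := hIcc (Ioo_subset_Icc_self hp)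
    div_pos (hφ'pos p hp') (pow_pos (hφpos p hp') 2)
  have hinc := monotoneOn_Ioo_iff_of_hasDerivAt_mul hab hratio hw hδc
  have hdec : AntitoneOn (fun t => ψ t / φ t) (Ioo a b) ↔ ∀ p ∈ Icc a b, δ p ≤ 0 := by
    have h := monotoneOn_Ioo_iff_of_hasDerivAt_mul (g := fun t => -(ψ t / φ t))
      (d := fun p => -δ p) hab
      (fun p hp => (hratio p hp).neg.congr_deriv (mul_neg _ _).symm) hw hδc.neg
    simp only [Left.nonneg_neg_iff] at h
    rw [← h]
    exact ⟨fun h => h.neg, fun h => by simpa using h.neg⟩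
  have hδmono : MonotoneOn δ (Icc a b) ∨ AntitoneOn δ (Icc a b) := by
    have hφ' := fun p hp => hφ'pos p (hIcc hp)
    have hφ0 := fun p hp => (hφpos p (hIcc hp)).le
    have hφ := fun p hp => hφd p (hIcc hp)
    refine hmono.imp (fun h => ?_) (fun h => ?_)
    · exact (monotoneOn_mul_sub_of_hasDerivAt hφ hψr hφ' hφ0 h).congr
        fun p hp => (hδ p (hIcc hp)).symm
    · have hneg := monotoneOn_mul_sub_of_hasDerivAt (ψ := fun p => -ψ p) (r := fun p => -r p)
        hφ (fun p hp => (hψr p hp).neg.congr_deriv (neg_mul _ _).symm) hφ' hφ0 h.neg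
      refine hneg.neg.congr fun p hp => ?_
      simp only [hδ p (hIcc hp)]
      ring
  have haI : a ∈ Icc a b := left_mem_Icc.2 hab.le
  have hbI : b ∈ Icc a b := right_mem_Icc.2 hab.le
  rw [hinc, hdec, mul_neg_iff]
  constructor
  · rintro ⟨hn, hp⟩
    push Not at hn hp
    obtain ⟨x, hx, hx0⟩ := hn
    obtain ⟨y, hy, hy0⟩ := hp
    rcases hδmono with h | h
    · exact .inr ⟨(h haI hx hx.1).trans_lt hx0, hy0.trans_le (h hy hbI hy.2)⟩
    · exact .inl ⟨hy0.trans_le (h haI hy hy.1), (h hx hbI hx.2).trans_lt hx0⟩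
  · rintro (⟨h1, h2⟩ | ⟨h1, h2⟩)
    · exact ⟨fun h => h2.not_ge (h b hbI), fun h => h1.not_ge (h a haI)⟩
    · exact ⟨fun h => h1.not_ge (h a haI), fun h => h2.not_ge (h b hbI)⟩
end

section
/- Let n ≥ 1 and 0 < p₁ < ⋯ < p_n < 1; set p₀ := 0 and p_{n+1} := 1, and assume that r is nondecreasing on (p_{k−1}, p_k) for every odd k and nonincreasing on (p_{k−1}, p_k) for every even k, for 1 ≤ k ≤ n+1 (so the quantile density ratio has modes exactly at p₁,…,p_n and is initially increasing; consequently δ is piecewise monotone and the limits lim_{p→0⁺} δ(p) and lim_{p→1⁻} δ(p) exist in the extended reals [−∞,+∞]). Then ψ/φ is nondecreasing on (0,1) — i.e., X ≤_* Y — if and only if lim_{p→0⁺} δ(p) ≥ 0, δ(p_k) ≥ 0 for every even index k with 2 ≤ k ≤ n, and, in the case where n is odd, also lim_{p→1⁻} δ(p) ≥ 0. -/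
open Set Filter Topology MeasureTheory intervalIntegral

theorem strictMonoOn_Ioo_of_hasDerivAt_pos {f f' : ℝ → ℝ} {a b : ℝ}
    (hf : ∀ x ∈ Ioo a b, HasDerivAt f (f' x) x) (hf' : ∀ x ∈ Ioo a b, 0 < f' x) :
    StrictMonoOn f (Ioo a b) := by
  apply strictMonoOn_of_deriv_pos (convex_Ioo a b)
    (fun x hx => (hf x hx).continuousAt.continuousWithinAt)
  intro x hx
  rw [interior_Ioo] at hx
  rw [(hf x hx).deriv]
  exact hf' x hx

theorem StrictMonoOn.pos_of_tendsto_right {f : ℝ → ℝ} {a b l : ℝ} (hf : StrictMonoOn f (Ioo a b))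
    (hlim : Tendsto f (𝓝[>] a) (𝓝 l)) (hl : 0 ≤ l) {x : ℝ} (hx : x ∈ Ioo a b) : 0 < f x := by
  obtain ⟨y, hay, hyx⟩ := exists_between hx.1
  have hy : y ∈ Ioo a b := ⟨hay, hyx.trans hx.2⟩
  have hly : l ≤ f y := by
    refine le_of_tendsto hlim ?_
    filter_upwards [Ioo_mem_nhdsGT hay] with z hz
    exact (hf ⟨hz.1, hz.2.trans hy.2⟩ hy hz.2).le
  linarith [hf hy hx hyx]

theorem hasDerivAt_div_eq_mul {φ ψ r : ℝ → ℝ} {u v x : ℝ} (hφ : HasDerivAt φ u x)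
    (hψ : HasDerivAt ψ v x) (hu : u ≠ 0) (hx : φ x ≠ 0) (hr : r x = v / u) :
    HasDerivAt (fun t => ψ t / φ t) (u / φ x ^ 2 * (φ x * r x - ψ x)) x := by
  have h : u / φ x ^ 2 * (φ x * r x - ψ x) = (v * φ x - ψ x * u) / φ x ^ 2 := by
    rw [hr]
    field_simp
  rw [h]
  exact hψ.fun_div hφ hx

/-- The mean value theorem of Cauchy, written for the defect of `ψ` against `φ`. -/
theorem exists_defect_sub_eq {φ ψ φ' ψ' r : ℝ → ℝ} {s t : ℝ} (hst : s < t)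
    (hφ : ∀ x ∈ Icc s t, HasDerivAt φ (φ' x) x) (hψ : ∀ x ∈ Icc s t, HasDerivAt ψ (ψ' x) x)
    (hφ' : ∀ x ∈ Icc s t, 0 < φ' x) (hr : ∀ x ∈ Icc s t, r x = ψ' x / φ' x) :
    ∃ c ∈ Ioo s t, (φ t * r t - ψ t) - (φ s * r s - ψ s) =
      φ t * (r t - r c) + φ s * (r c - r s) := by
  obtain ⟨c, hc, h⟩ := exists_ratio_hasDerivAt_eq_ratio_slope φ φ' hst
    (fun x hx => (hφ x hx).continuousAt.continuousWithinAt)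
    (fun x hx => hφ x (Ioo_subset_Icc_self hx)) ψ ψ'
    (fun x hx => (hψ x hx).continuousAt.continuousWithinAt)
    (fun x hx => hψ x (Ioo_subset_Icc_self hx))
  refine ⟨c, hc, ?_⟩
  have hc' := Ioo_subset_Icc_self hc
  have hne := (hφ' c hc').ne'
  have key : ψ t - ψ s = r c * (φ t - φ s) := by
    rw [hr c hc']
    field_simp
    linarith
  linear_combination -key

theorem MonotoneOn.nonneg_of_tendsto_left_endpoint {f : ℝ → ℝ} {a b : ℝ} {L : EReal}
    (hf : MonotoneOn f (Ioo a b)) (hlim : Tendsto (fun q => (f q : EReal)) (𝓝[>] a) (𝓝 L))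
    (hL : 0 ≤ L) {x : ℝ} (hx : x ∈ Ioo a b) : 0 ≤ f x := by
  have h : L ≤ (f x : EReal) := by
    refine le_of_tendsto hlim ?_
    filter_upwards [Ioo_mem_nhdsGT hx.1] with z hz
    exact EReal.coe_le_coe_iff.2 (hf ⟨hz.1, hz.2.trans hx.2⟩ hx hz.2.le)
  exact_mod_cast hL.trans h

theorem AntitoneOn.nonneg_of_tendsto_right_endpoint {f : ℝ → ℝ} {a b : ℝ} {L : EReal}
    (hf : AntitoneOn f (Ioo a b)) (hlim : Tendsto (fun q => (f q : EReal)) (𝓝[<] b) (𝓝 L))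
    (hL : 0 ≤ L) {x : ℝ} (hx : x ∈ Ioo a b) : 0 ≤ f x := by
  have h : L ≤ (f x : EReal) := by
    refine le_of_tendsto hlim ?_
    filter_upwards [Ioo_mem_nhdsLT hx.2] with z hz
    exact EReal.coe_le_coe_iff.2 (hf hx ⟨hx.1.trans hz.1, hz.2⟩ hz.1.le)
  exact_mod_cast hL.trans h

theorem stmt2
    (φ ψ φ' ψ' r δ : ℝ → ℝ)
    (hφd : ∀ p ∈ Ioo (0:ℝ) 1, HasDerivAt φ (φ' p) p)
    (hψd : ∀ p ∈ Ioo (0:ℝ) 1, HasDerivAt ψ (ψ' p) p)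
    (hφ'pos : ∀ p ∈ Ioo (0:ℝ) 1, 0 < φ' p)
    (hψ'pos : ∀ p ∈ Ioo (0:ℝ) 1, 0 < ψ' p)
    (hr : ∀ p ∈ Ioo (0:ℝ) 1, r p = ψ' p / φ' p)
    (hrc : ContinuousOn r (Ioo 0 1))
    (lX lY : ℝ)
    (hlX : Tendsto φ (𝓝[>] (0:ℝ)) (𝓝 lX))
    (hlY : Tendsto ψ (𝓝[>] (0:ℝ)) (𝓝 lY))
    (hlX0 : 0 ≤ lX) (hlY0 : 0 ≤ lY)
    (hδ : ∀ p ∈ Ioo (0:ℝ) 1, δ p = φ p * r p - ψ p)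
    (n : ℕ) (hn : 1 ≤ n) (p : ℕ → ℝ)
    (hp0 : p 0 = 0) (hplast : p (n+1) = 1)
    (hpmono : ∀ k ≤ n, p k < p (k+1))
    (hodd : ∀ k, 1 ≤ k → k ≤ n+1 → Odd k → MonotoneOn r (Ioo (p (k-1)) (p k)))
    (heven : ∀ k, 1 ≤ k → k ≤ n+1 → Even k → AntitoneOn r (Ioo (p (k-1)) (p k)))
    (L₀ L₁ : EReal)
    (hL₀ : Tendsto (fun q => (δ q : EReal)) (𝓝[>] (0:ℝ)) (𝓝 L₀))
    (hL₁ : Tendsto (fun q => (δ q : EReal)) (𝓝[<] (1:ℝ)) (𝓝 L₁))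
 :
    MonotoneOn (fun t => ψ t / φ t) (Ioo 0 1) ↔
      (0 ≤ L₀ ∧ (∀ k, 2 ≤ k → k ≤ n → Even k → 0 ≤ δ (p k)) ∧ (Odd n → 0 ≤ L₁)) := by
  have hφpos : ∀ x ∈ Ioo (0:ℝ) 1, 0 < φ x := fun x hx =>
    (strictMonoOn_Ioo_of_hasDerivAt_pos hφd hφ'pos).pos_of_tendsto_right hlX hlX0 hx
  have hδc : ContinuousOn δ (Ioo 0 1) := by
    have hφc : ContinuousOn φ (Ioo 0 1) := fun x hx =>
      (hφd x hx).continuousAt.continuousWithinAt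
    have hψc : ContinuousOn ψ (Ioo 0 1) := fun x hx =>
      (hψd x hx).continuousAt.continuousWithinAt
    exact ((hφc.mul hrc).sub hψc).congr hδ
  have hδat : ∀ x ∈ Ioo (0:ℝ) 1, Tendsto (fun q => (δ q : EReal)) (𝓝 x) (𝓝 (δ x : EReal)) :=
    fun x hx => (continuous_coe_real_ereal.tendsto _).comp
      (hδc.continuousAt (isOpen_Ioo.mem_nhds hx))
  have hderiv : ∀ x ∈ Ioo (0:ℝ) 1,
      HasDerivAt (fun t => ψ t / φ t) (φ' x / φ x ^ 2 * δ x) x := fun x hx => by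
    rw [hδ x hx]
    exact hasDerivAt_div_eq_mul (hφd x hx) (hψd x hx) (hφ'pos x hx).ne' (hφpos x hx).ne' (hr x hx)
  have hcoef : ∀ x ∈ Ioo (0:ℝ) 1, 0 < φ' x / φ x ^ 2 := fun x hx =>
    div_pos (hφ'pos x hx) (pow_pos (hφpos x hx) 2)
  have hiff : MonotoneOn (fun t => ψ t / φ t) (Ioo 0 1) ↔ ∀ x ∈ Ioo (0:ℝ) 1, 0 ≤ δ x := by
    constructor
    · intro h x hx
      have h1 := h.derivWithin_nonneg (x := x)
      rw [(hderiv x hx).hasDerivWithinAt.derivWithin (isOpen_Ioo.uniqueDiffWithinAt hx)] at h1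
      exact nonneg_of_mul_nonneg_right h1 (hcoef x hx)
    · intro h
      refine monotoneOn_of_deriv_nonneg (convex_Ioo 0 1)
        (fun x hx => (hderiv x hx).continuousAt.continuousWithinAt) ?_ ?_ <;>
      rw [interior_Ioo]
      · exact fun x hx => (hderiv x hx).differentiableAt.differentiableWithinAt
      · intro x hx
        rw [(hderiv x hx).deriv]
        exact mul_nonneg (hcoef x hx).le (h x hx)
  have hpstrict : StrictMonoOn p (Iic (n + 1)) := by
    refine strictMonoOn_of_lt_add_one ordConnected_Iic ?_
    intro k _ _ hk
    exact hpmono k (Nat.le_of_succ_le_succ hk)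
  have hpmem : ∀ k, 1 ≤ k → k ≤ n → p k ∈ Ioo (0:ℝ) 1 := by
    intro k h1 hk
    rw [← hp0, ← hplast]
    exact ⟨hpstrict (mem_Iic.2 (by omega)) (mem_Iic.2 (by omega)) (by omega),
      hpstrict (mem_Iic.2 (by omega)) (mem_Iic.2 (by omega)) (by omega)⟩
  have hsub : ∀ k ≤ n, Ioo (p k) (p (k + 1)) ⊆ Ioo 0 1 := by
    intro k hk
    rw [← hp0, ← hplast]
    exact Ioo_subset_Ioo
      (hpstrict.monotoneOn (mem_Iic.2 (by omega)) (mem_Iic.2 (by omega)) (by omega))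
      (hpstrict.monotoneOn (mem_Iic.2 (by omega)) (mem_Iic.2 (by omega)) (by omega))
  have hdefect : ∀ s ∈ Ioo (0:ℝ) 1, ∀ t ∈ Ioo (0:ℝ) 1, s < t → ∃ c ∈ Ioo s t,
      δ t - δ s = φ t * (r t - r c) + φ s * (r c - r s) := by
    intro s hs t ht hst
    have hI : Icc s t ⊆ Ioo 0 1 := Icc_subset_Ioo hs.1 ht.2
    rw [hδ s hs, hδ t ht]
    exact exists_defect_sub_eq hst (fun x hx => hφd x (hI hx)) (fun x hx => hψd x (hI hx))
      (fun x hx => hφ'pos x (hI hx)) (fun x hx => hr x (hI hx))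
  have hδmono : ∀ k ≤ n, Even k → MonotoneOn δ (Ioo (p k) (p (k + 1))) := by
    intro k hk hke s hs t ht hst
    rcases hst.eq_or_lt with rfl | hst
    · exact le_rfl
    obtain ⟨c, hc, h⟩ := hdefect s (hsub k hk hs) t (hsub k hk ht) hst
    have hrm : MonotoneOn r (Ioo (p k) (p (k + 1))) :=
      hodd (k + 1) (by omega) (by omega) hke.add_one
    have hcI : c ∈ Ioo (p k) (p (k + 1)) := ⟨hs.1.trans hc.1, hc.2.trans ht.2⟩
    have h1 := mul_nonneg (hφpos t (hsub k hk ht)).le (sub_nonneg.2 (hrm hcI ht hc.2.le))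
    have h2 := mul_nonneg (hφpos s (hsub k hk hs)).le (sub_nonneg.2 (hrm hs hcI hc.1.le))
    linarith
  have hδanti : ∀ k ≤ n, Odd k → AntitoneOn δ (Ioo (p k) (p (k + 1))) := by
    intro k hk hko s hs t ht hst
    rcases hst.eq_or_lt with rfl | hst
    · exact le_rfl
    obtain ⟨c, hc, h⟩ := hdefect s (hsub k hk hs) t (hsub k hk ht) hst
    have hrm : AntitoneOn r (Ioo (p k) (p (k + 1))) :=
      heven (k + 1) (by omega) (by omega) hko.add_one
    have hcI : c ∈ Ioo (p k) (p (k + 1)) := ⟨hs.1.trans hc.1, hc.2.trans ht.2⟩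
    have h1 := mul_nonneg (hφpos t (hsub k hk ht)).le (sub_nonneg.2 (hrm hcI ht hc.2.le))
    have h2 := mul_nonneg (hφpos s (hsub k hk hs)).le (sub_nonneg.2 (hrm hs hcI hc.1.le))
    linarith
  rw [hiff]
  constructor
  · intro h
    refine ⟨ge_of_tendsto hL₀ ?_, fun k h2 hk _ => h _ (hpmem k (by omega) hk),
      fun _ => ge_of_tendsto hL₁ ?_⟩
    · filter_upwards [Ioo_mem_nhdsGT (zero_lt_one' ℝ)] with x hx
      exact_mod_cast h x hx
    · filter_upwards [Ioo_mem_nhdsLT (zero_lt_one' ℝ)] with x hx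
      exact_mod_cast h x hx
  · rintro ⟨h0, hmid, h1⟩
    have hopen : ∀ k ≤ n, ∀ x ∈ Ioo (p k) (p (k + 1)), 0 ≤ δ x := by
      intro k hk x hx
      rcases Nat.even_or_odd k with hke | hko
      · rcases Nat.eq_zero_or_pos k with rfl | hkpos
        · exact (hδmono 0 hk hke).nonneg_of_tendsto_left_endpoint (hp0 ▸ hL₀) h0 hx
        · have hk2 : 2 ≤ k := by
            obtain ⟨m, rfl⟩ := hke
            omega
          exact (hδmono k hk hke).nonneg_of_tendsto_left_endpoint
            ((hδat _ (hpmem k hkpos hk)).mono_left nhdsWithin_le_nhds)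
            (EReal.coe_nonneg.2 (hmid k hk2 hk hke)) hx
      · rcases hk.eq_or_lt with rfl | hkn
        · exact (hδanti k hk hko).nonneg_of_tendsto_right_endpoint (hplast ▸ hL₁) (h1 hko) hx
        · exact (hδanti k hk hko).nonneg_of_tendsto_right_endpoint
            ((hδat _ (hpmem (k + 1) (by omega) hkn)).mono_left nhdsWithin_le_nhds)
            (EReal.coe_nonneg.2 (hmid (k + 1) (by grind) hkn hko.add_one)) hx
    intro x hx
    have hex : ∃ k, x ≤ p k := ⟨n + 1, hplast ▸ hx.2.le⟩
    classical
    obtain ⟨k, hk⟩ : ∃ k, Nat.find hex = k + 1 := by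
      refine Nat.exists_eq_succ_of_ne_zero fun h => ?_
      have := Nat.find_spec hex
      rw [h, hp0] at this
      exact absurd hx.1 this.not_gt
    have hkn : k ≤ n := by
      have := Nat.find_min' hex (hplast ▸ hx.2.le : x ≤ p (n + 1))
      omega
    have hle : x ≤ p (k + 1) := hk ▸ Nat.find_spec hex
    have hlt : p k < x := not_le.1 (Nat.find_min hex (by omega))
    rcases hle.eq_or_lt with rfl | hlt'
    · refine ge_of_tendsto ((hδc.continuousAt (isOpen_Ioo.mem_nhds hx)).tendsto.mono_left
        (nhdsWithin_le_nhds (s := Iio (p (k + 1))))) ?_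
      filter_upwards [Ioo_mem_nhdsLT hlt] with y hy
      exact hopen k hkn y hy
    · exact hopen k hkn x ⟨hlt, hlt'⟩
end

section
/- Let n ≥ 1 and 0 < p₁ < ⋯ < p_n < 1; set p₀ := 0 and p_{n+1} := 1, and assume that r is nondecreasing on (p_{k−1}, p_k) for every odd k and nonincreasing on (p_{k−1}, p_k) for every even k, for 1 ≤ k ≤ n+1 (so the quantile density ratio has modes exactly at p₁,…,p_n and is initially increasing; consequently δ is piecewise monotone and the limit lim_{p→1⁻} δ(p) exists in the extended reals [−∞,+∞]). Then ψ/φ is nonincreasing on (0,1) — i.e., X ≥_* Y — if and only if δ(p_k) ≤ 0 for every odd index k with 1 ≤ k ≤ n and, in the case where n is even, also lim_{p→1⁻} δ(p) ≤ 0. -/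
open Set Filter Topology MeasureTheory intervalIntegral

/-- Increment formula for `φ * r - ψ`, obtained from Cauchy's mean value theorem, when
`ψ' = r * φ'`. -/
theorem exists_mul_sub_increment_eq {φ ψ φ' r : ℝ → ℝ} {s t : ℝ} (hst : s < t)
    (hφ : ∀ x ∈ Icc s t, HasDerivAt φ (φ' x) x)
    (hψ : ∀ x ∈ Icc s t, HasDerivAt ψ (r x * φ' x) x)
    (hφ' : ∀ x ∈ Icc s t, 0 < φ' x) :
    ∃ c ∈ Ioo s t, φ t * r t - ψ t - (φ s * r s - ψ s) =
      φ s * (r t - r s) + (φ t - φ s) * (r t - r c) := by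
  obtain ⟨c, hc, h⟩ := exists_ratio_hasDerivAt_eq_ratio_slope φ φ' hst
    (fun x hx => (hφ x hx).continuousAt.continuousWithinAt)
    (fun x hx => hφ x (Ioo_subset_Icc_self hx)) ψ (fun x => r x * φ' x)
    (fun x hx => (hψ x hx).continuousAt.continuousWithinAt)
    (fun x hx => hψ x (Ioo_subset_Icc_self hx))
  have h' : ψ t - ψ s = (φ t - φ s) * r c := by
    apply mul_right_cancel₀ (hφ' c (Ioo_subset_Icc_self hc)).ne'
    linarith
  exact ⟨c, hc, by linarith⟩

theorem MonotoneOn.le_of_tendsto_left {α : Type*} [TopologicalSpace α] [Preorder α]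
    [OrderClosedTopology α] {f : ℝ → α} {a b t : ℝ} {L : α} (hf : MonotoneOn f (Ioo a b))
    (ht : t ∈ Ioo a b) (hL : Tendsto f (𝓝[<] b) (𝓝 L)) : f t ≤ L := by
  refine ge_of_tendsto hL ?_
  filter_upwards [Ioo_mem_nhdsLT ht.2] with x hx
  exact hf ht ⟨ht.1.trans hx.1, hx.2⟩ hx.1.le

theorem AntitoneOn.le_of_tendsto_right {α : Type*} [TopologicalSpace α] [Preorder α]
    [OrderClosedTopology α] {f : ℝ → α} {a b t : ℝ} {L : α} (hf : AntitoneOn f (Ioo a b))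
    (ht : t ∈ Ioo a b) (hL : Tendsto f (𝓝[>] a) (𝓝 L)) : f t ≤ L := by
  refine ge_of_tendsto hL ?_
  filter_upwards [Ioo_mem_nhdsGT ht.1] with x hx
  exact hf ⟨hx.1, hx.2.trans ht.2⟩ ht hx.2.le

theorem antitoneOn_iff_hasDerivAt_nonpos {f f' : ℝ → ℝ} {a b : ℝ}
    (hf : ∀ x ∈ Ioo a b, HasDerivAt f (f' x) x) :
    AntitoneOn f (Ioo a b) ↔ ∀ x ∈ Ioo a b, f' x ≤ 0 := by
  constructor
  · intro h x hx
    rw [← (hf x hx).deriv, ← derivWithin_of_isOpen isOpen_Ioo hx]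
    exact h.derivWithin_nonpos
  · intro h
    refine antitoneOn_of_deriv_nonpos (convex_Ioo a b)
      (fun x hx => (hf x hx).continuousAt.continuousWithinAt) ?_ ?_
    · rw [interior_Ioo]
      exact fun x hx => (hf x hx).differentiableAt.differentiableWithinAt
    · rw [interior_Ioo]
      intro x hx
      rw [(hf x hx).deriv]
      exact h x hx

theorem stmt3
    (φ ψ φ' ψ' r δ : ℝ → ℝ)
    (hφd : ∀ p ∈ Ioo (0:ℝ) 1, HasDerivAt φ (φ' p) p)
    (hψd : ∀ p ∈ Ioo (0:ℝ) 1, HasDerivAt ψ (ψ' p) p)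
    (hφ'pos : ∀ p ∈ Ioo (0:ℝ) 1, 0 < φ' p)
    (hψ'pos : ∀ p ∈ Ioo (0:ℝ) 1, 0 < ψ' p)
    (hr : ∀ p ∈ Ioo (0:ℝ) 1, r p = ψ' p / φ' p)
    (hrc : ContinuousOn r (Ioo 0 1))
    (lX lY : ℝ)
    (hlX : Tendsto φ (𝓝[>] (0:ℝ)) (𝓝 lX))
    (hlY : Tendsto ψ (𝓝[>] (0:ℝ)) (𝓝 lY))
    (hlX0 : 0 ≤ lX) (hlY0 : 0 ≤ lY)
    (hδ : ∀ p ∈ Ioo (0:ℝ) 1, δ p = φ p * r p - ψ p)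
    (n : ℕ) (hn : 1 ≤ n) (p : ℕ → ℝ)
    (hp0 : p 0 = 0) (hplast : p (n+1) = 1)
    (hpmono : ∀ k ≤ n, p k < p (k+1))
    (hodd : ∀ k, 1 ≤ k → k ≤ n+1 → Odd k → MonotoneOn r (Ioo (p (k-1)) (p k)))
    (heven : ∀ k, 1 ≤ k → k ≤ n+1 → Even k → AntitoneOn r (Ioo (p (k-1)) (p k)))
    (L₀ L₁ : EReal)
    (hL₀ : Tendsto (fun q => (δ q : EReal)) (𝓝[>] (0:ℝ)) (𝓝 L₀))
    (hL₁ : Tendsto (fun q => (δ q : EReal)) (𝓝[<] (1:ℝ)) (𝓝 L₁))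
 :
    AntitoneOn (fun t => ψ t / φ t) (Ioo 0 1) ↔
      ((∀ k, 1 ≤ k → k ≤ n → Odd k → δ (p k) ≤ 0) ∧ (Even n → L₁ ≤ 0)) := by
  have hψr : ∀ x ∈ Ioo (0:ℝ) 1, ψ' x = r x * φ' x := fun x hx => by
    rw [hr x hx, div_mul_cancel₀ _ (hφ'pos x hx).ne']
  have hφmono : StrictMonoOn φ (Ioo 0 1) := by
    refine strictMonoOn_of_deriv_pos (convex_Ioo 0 1)
      (fun x hx => (hφd x hx).continuousAt.continuousWithinAt) ?_
    rw [interior_Ioo]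
    intro x hx
    rw [(hφd x hx).deriv]
    exact hφ'pos x hx
  have hφpos : ∀ x ∈ Ioo (0:ℝ) 1, 0 < φ x := by
    intro x hx
    have hx2 : x / 2 ∈ Ioo (0:ℝ) 1 := ⟨by linarith [hx.1], by linarith [hx.1, hx.2]⟩
    have h1 : lX ≤ φ (x / 2) := by
      refine le_of_tendsto hlX ?_
      filter_upwards [Ioo_mem_nhdsGT hx2.1] with y hy
      exact (hφmono ⟨hy.1, hy.2.trans hx2.2⟩ hx2 hy.2).le
    have h2 : φ (x / 2) < φ x := hφmono hx2 hx (by linarith [hx.1])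
    linarith
  have hmono_iff : AntitoneOn (fun t => ψ t / φ t) (Ioo 0 1) ↔
      ∀ x ∈ Ioo (0:ℝ) 1, δ x ≤ 0 := by
    rw [antitoneOn_iff_hasDerivAt_nonpos
      (fun x hx => (hψd x hx).fun_div (hφd x hx) (hφpos x hx).ne')]
    refine forall₂_congr fun x hx => ?_
    have e : (ψ' x * φ x - ψ x * φ' x) / φ x ^ 2 = φ' x / φ x ^ 2 * δ x := by
      rw [hψr x hx, hδ x hx]
      ring
    rw [e]
    have hc : 0 < φ' x / φ x ^ 2 := div_pos (hφ'pos x hx) (pow_pos (hφpos x hx) 2)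
    simpa using mul_le_mul_iff_right₀ (b := δ x) (c := 0) hc
  have hδc : ∀ x ∈ Ioo (0:ℝ) 1, ContinuousAt δ x := by
    intro x hx
    have hmem := isOpen_Ioo.mem_nhds hx
    refine ContinuousAt.congr (f := fun y => φ y * r y - ψ y) ?_ ?_
    · exact ((hφd x hx).continuousAt.mul (hrc.continuousAt hmem)).sub (hψd x hx).continuousAt
    · filter_upwards [hmem] with y hy
      exact (hδ y hy).symm
  have hincr : ∀ s ∈ Ioo (0:ℝ) 1, ∀ t ∈ Ioo (0:ℝ) 1, s < t → ∃ c ∈ Ioo s t,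
      δ t - δ s = φ s * (r t - r s) + (φ t - φ s) * (r t - r c) := by
    intro s hs t ht hst
    have hsub : Icc s t ⊆ Ioo (0:ℝ) 1 := Icc_subset_Ioo hs.1 ht.2
    rw [hδ s hs, hδ t ht]
    exact exists_mul_sub_increment_eq hst (fun x hx => hφd x (hsub hx))
      (fun x hx => hψr x (hsub hx) ▸ hψd x (hsub hx)) (fun x hx => hφ'pos x (hsub hx))
  have hδmono : ∀ a b : ℝ, Ioo a b ⊆ Ioo 0 1 → MonotoneOn r (Ioo a b) →
      MonotoneOn δ (Ioo a b) := by
    intro a b hab hm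
    intro s hs t ht hst
    rcases hst.eq_or_lt with rfl | hst
    · rfl
    obtain ⟨c, hc, h⟩ := hincr s (hab hs) t (hab ht) hst
    have hcm : c ∈ Ioo a b := ⟨hs.1.trans hc.1, hc.2.trans ht.2⟩
    have h1 := mul_nonneg (hφpos s (hab hs)).le (sub_nonneg.2 (hm hs ht hst.le))
    have h2 := mul_nonneg (sub_nonneg.2 (hφmono (hab hs) (hab ht) hst).le)
      (sub_nonneg.2 (hm hcm ht hc.2.le))
    linarith
  have hδanti : ∀ a b : ℝ, Ioo a b ⊆ Ioo 0 1 → AntitoneOn r (Ioo a b) →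
      AntitoneOn δ (Ioo a b) := by
    intro a b hab hm
    intro s hs t ht hst
    rcases hst.eq_or_lt with rfl | hst
    · rfl
    obtain ⟨c, hc, h⟩ := hincr s (hab hs) t (hab ht) hst
    have hcm : c ∈ Ioo a b := ⟨hs.1.trans hc.1, hc.2.trans ht.2⟩
    have h1 := mul_nonpos_of_nonneg_of_nonpos (hφpos s (hab hs)).le (sub_nonpos.2 (hm hs ht hst.le))
    have h2 := mul_nonpos_of_nonneg_of_nonpos (sub_nonneg.2 (hφmono (hab hs) (hab ht) hst).le)
      (sub_nonpos.2 (hm hcm ht hc.2.le))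
    linarith
  have hple : ∀ i j, i ≤ j → j ≤ n + 1 → p i ≤ p j := by
    intro i j hij
    induction j, hij using Nat.le_induction with
    | base => exact fun _ => le_rfl
    | succ j _ ih => exact fun hj => (ih (by omega)).trans (hpmono j (by omega)).le
  have hpIoo : ∀ k, 1 ≤ k → k ≤ n → p k ∈ Ioo (0:ℝ) 1 := fun k h1 hk =>
    ⟨hp0 ▸ (hpmono 0 (by omega)).trans_le (hple 1 k h1 (by omega)),
      hplast ▸ (hpmono k hk).trans_le (hple (k + 1) (n + 1) (by omega) le_rfl)⟩
  have hsub : ∀ k ≤ n, Ioo (p k) (p (k + 1)) ⊆ Ioo 0 1 := fun k hk =>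
    Ioo_subset_Ioo (hp0 ▸ hple 0 k (by omega) (by omega))
      (hplast ▸ hple (k + 1) (n + 1) (by omega) le_rfl)
  rw [hmono_iff]
  constructor
  · refine fun h => ⟨fun k h1 hk _ => h _ (hpIoo k h1 hk), fun _ => le_of_tendsto hL₁ ?_⟩
    filter_upwards [Ioo_mem_nhdsLT (zero_lt_one' ℝ)] with x hx
    exact_mod_cast h x hx
  · rintro ⟨hmodes, hlast⟩ t ht
    have hex : ∃ k, t ≤ p k := ⟨n + 1, hplast ▸ ht.2.le⟩
    classical
    obtain ⟨k, hk, hlt, hle⟩ : ∃ k ≤ n, p k < t ∧ t ≤ p (k + 1) := by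
      have hfind := Nat.find_spec hex
      have hmin : Nat.find hex ≤ n + 1 := Nat.find_min' hex (hplast ▸ ht.2.le)
      rcases hk : Nat.find hex with _ | k
      · rw [hk, hp0] at hfind
        exact absurd ht.1 hfind.not_gt
      · exact ⟨k, by omega, not_le.1 (Nat.find_min hex (m := k) (by omega)), hk ▸ hfind⟩
    rcases Nat.even_or_odd k with hev | hod
    · have hm := hδmono _ _ (hsub k hk) (hodd (k + 1) (by omega) (by omega) hev.add_one)
      rcases hk.lt_or_eq with hkn | rfl
      · have hmode := hmodes (k + 1) (by omega) hkn hev.add_one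
        rcases hle.lt_or_eq with hlt' | rfl
        · exact (hm.le_of_tendsto_left ⟨hlt, hlt'⟩
            ((hδc _ (hpIoo (k + 1) (by omega) hkn)).mono_left nhdsWithin_le_nhds)).trans hmode
        · exact hmode
      · have hm' : MonotoneOn (fun q => (δ q : EReal)) (Ioo (p k) (p (k + 1))) :=
          fun x hx y hy hxy => EReal.coe_le_coe_iff.2 (hm hx hy hxy)
        have := (hm'.le_of_tendsto_left ⟨hlt, hplast ▸ ht.2⟩ (hplast ▸ hL₁)).trans (hlast hev)
        exact_mod_cast this
    · have hk1 : 1 ≤ k := hod.pos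
      have hmode := hmodes k hk1 hk hod
      have ha := hδanti _ _ (hsub k hk) (heven (k + 1) (by omega) (by omega) hod.add_one)
      have hright : Tendsto δ (𝓝[>] (p k)) (𝓝 (δ (p k))) :=
        (hδc _ (hpIoo k hk1 hk)).mono_left nhdsWithin_le_nhds
      rcases hle.lt_or_eq with hlt' | rfl
      · exact (ha.le_of_tendsto_right ⟨hlt, hlt'⟩ hright).trans hmode
      · have hleft := (hδc _ ht).mono_left (nhdsWithin_le_nhds (s := Iio (p (k + 1))))
        refine (le_of_tendsto hleft ?_ : δ (p (k + 1)) ≤ δ (p k)).trans hmode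
        filter_upwards [Ioo_mem_nhdsLT hlt] with x hx
        exact ha.le_of_tendsto_right hx hright
end

section
/- Assume the unimodality hypothesis. If L₀ ≥ 0 and L₁ ≥ 0, then the ratio p ↦ ψ(p)/φ(p) is monotone nondecreasing on (0,1). (Theorem 2.1, Case 1.) -/
open Set Filter Topology MeasureTheory intervalIntegral

/-- Cauchy's mean value theorem, with the quotient of derivatives written as a function `r`. -/
lemma exists_sub_eq_ratio_mul_sub {φ ψ φ' ψ' r : ℝ → ℝ} {a b : ℝ} (hab : a < b)
    (hφ : ∀ p ∈ Icc a b, HasDerivAt φ (φ' p) p) (hψ : ∀ p ∈ Icc a b, HasDerivAt ψ (ψ' p) p)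
    (hφ' : ∀ p ∈ Icc a b, 0 < φ' p) (hr : ∀ p ∈ Icc a b, r p = ψ' p / φ' p) :
    ∃ c ∈ Ioo a b, ψ b - ψ a = r c * (φ b - φ a) := by
  obtain ⟨c, hc, h⟩ := exists_ratio_hasDerivAt_eq_ratio_slope φ φ' hab
    (fun p hp => (hφ p hp).continuousAt.continuousWithinAt)
    (fun p hp => hφ p (Ioo_subset_Icc_self hp)) ψ ψ'
    (fun p hp => (hψ p hp).continuousAt.continuousWithinAt)
    (fun p hp => hψ p (Ioo_subset_Icc_self hp))
  refine ⟨c, hc, ?_⟩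
  have hpos := hφ' c (Ioo_subset_Icc_self hc)
  rw [hr c (Ioo_subset_Icc_self hc)]
  field_simp
  linarith

/-- A quotient with nonnegative Wronskian `ψ' φ - ψ φ'` in the interior of a convex set is
monotone there. -/
lemma monotoneOn_div_of_wronskian_nonneg {φ ψ φ' ψ' : ℝ → ℝ} {s : Set ℝ} (hs : Convex ℝ s)
    (hφ : ∀ p ∈ s, HasDerivAt φ (φ' p) p) (hψ : ∀ p ∈ s, HasDerivAt ψ (ψ' p) p)
    (hφ0 : ∀ p ∈ s, φ p ≠ 0) (hW : ∀ p ∈ interior s, 0 ≤ ψ' p * φ p - ψ p * φ' p) :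
    MonotoneOn (fun t => ψ t / φ t) s := by
  have hd : ∀ p ∈ s, HasDerivAt (fun t => ψ t / φ t)
      ((ψ' p * φ p - ψ p * φ' p) / φ p ^ 2) p :=
    fun p hp => (hψ p hp).fun_div (hφ p hp) (hφ0 p hp)
  refine monotoneOn_of_deriv_nonneg hs
    (fun p hp => (hd p hp).continuousAt.continuousWithinAt)
    (fun p hp => (hd p (interior_subset hp)).differentiableAt.differentiableWithinAt) ?_
  intro p hp
  rw [(hd p (interior_subset hp)).deriv]
  exact div_nonneg (hW p hp) (sq_nonneg _)

theorem stmt4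
    (φ ψ φ' ψ' r δ : ℝ → ℝ)
    (hφd : ∀ p ∈ Ioo (0:ℝ) 1, HasDerivAt φ (φ' p) p)
    (hψd : ∀ p ∈ Ioo (0:ℝ) 1, HasDerivAt ψ (ψ' p) p)
    (hφ'pos : ∀ p ∈ Ioo (0:ℝ) 1, 0 < φ' p)
    (hψ'pos : ∀ p ∈ Ioo (0:ℝ) 1, 0 < ψ' p)
    (hr : ∀ p ∈ Ioo (0:ℝ) 1, r p = ψ' p / φ' p)
    (hrc : ContinuousOn r (Ioo 0 1))
    (lX lY : ℝ)
    (hlX : Tendsto φ (𝓝[>] (0:ℝ)) (𝓝 lX))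
    (hlY : Tendsto ψ (𝓝[>] (0:ℝ)) (𝓝 lY))
    (hlX0 : 0 ≤ lX) (hlY0 : 0 ≤ lY)
    (hδ : ∀ p ∈ Ioo (0:ℝ) 1, δ p = φ p * r p - ψ p)
    (pstar : ℝ) (hpstar : pstar ∈ Ioo (0:ℝ) 1)
    (hrup : MonotoneOn r (Ioo 0 pstar))
    (hrdown : AntitoneOn r (Ioo pstar 1))
    (L₀ L₁ : EReal)
    (hL₀ : Tendsto (fun q => (δ q : EReal)) (𝓝[>] (0:ℝ)) (𝓝 L₀))
    (hL₁ : Tendsto (fun q => (δ q : EReal)) (𝓝[<] (1:ℝ)) (𝓝 L₁))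
    (h0 : 0 ≤ L₀) (h1 : 0 ≤ L₁) :
    MonotoneOn (fun t => ψ t / φ t) (Ioo 0 1) := by
  obtain ⟨hp0, hp1⟩ := hpstar
  have hmono : StrictMonoOn φ (Ioo 0 1) := by
    refine strictMonoOn_of_deriv_pos (convex_Ioo 0 1)
      (fun p hp => (hφd p hp).continuousAt.continuousWithinAt) ?_
    intro p hp
    rw [interior_Ioo] at hp
    rw [(hφd p hp).deriv]
    exact hφ'pos p hp
  have hφpos : ∀ p ∈ Ioo (0:ℝ) 1, 0 < φ p := by
    intro p hp
    have hm : p / 2 ∈ Ioo (0:ℝ) 1 := ⟨by linarith [hp.1], by linarith [hp.1, hp.2]⟩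
    have hle : lX ≤ φ (p / 2) := by
      refine le_of_tendsto hlX ?_
      filter_upwards [Ioo_mem_nhdsGT hm.1] with q hq
      exact (hmono ⟨hq.1, hq.2.trans hm.2⟩ hm hq.2).le
    have hlt := hmono hm hp (by linarith [hp.1])
    linarith
  have hcauchy : ∀ {a b : ℝ}, 0 < a → a < b → b < 1 →
      φ a < φ b ∧ ∃ c ∈ Ioo a b, ψ b - ψ a = r c * (φ b - φ a) := by
    intro a b ha hab hb
    have hsub : ∀ p ∈ Icc a b, p ∈ Ioo (0:ℝ) 1 :=
      fun p hp => ⟨ha.trans_le hp.1, hp.2.trans_lt hb⟩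
    exact ⟨hmono ⟨ha, hab.trans hb⟩ ⟨ha.trans hab, hb⟩ hab,
      exists_sub_eq_ratio_mul_sub hab (fun p hp => hφd p (hsub p hp))
        (fun p hp => hψd p (hsub p hp)) (fun p hp => hφ'pos p (hsub p hp))
        (fun p hp => hr p (hsub p hp))⟩
  have hδleft : ∀ p ∈ Ioo 0 pstar, 0 ≤ δ p := by
    intro b hb
    have hL : L₀ ≤ (δ b : EReal) := by
      refine le_of_tendsto hL₀ ?_
      filter_upwards [Ioo_mem_nhdsGT hb.1] with a ha
      have hb1 : b < 1 := hb.2.trans hp1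
      have ha1 : a < 1 := ha.2.trans hb1
      have haI : a ∈ Ioo 0 pstar := ⟨ha.1, ha.2.trans hb.2⟩
      obtain ⟨hφab, c, hc, h⟩ := hcauchy ha.1 ha.2 hb1
      have hcb := hrup ⟨ha.1.trans hc.1, hc.2.trans hb.2⟩ hb hc.2.le
      have hab := hrup haI hb ha.2.le
      rw [EReal.coe_le_coe_iff, hδ a ⟨ha.1, ha1⟩, hδ b ⟨hb.1, hb1⟩]
      have hφa := hφpos a ⟨ha.1, ha1⟩
      nlinarith [mul_le_mul_of_nonneg_right hcb (sub_nonneg.2 hφab.le),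
        mul_le_mul_of_nonneg_left hab hφa.le]
    exact_mod_cast h0.trans hL
  have hδright : ∀ p ∈ Ioo pstar 1, 0 ≤ δ p := by
    intro a ha
    have hL : L₁ ≤ (δ a : EReal) := by
      refine le_of_tendsto hL₁ ?_
      filter_upwards [Ioo_mem_nhdsLT ha.2] with b hb
      have ha0 : 0 < a := hp0.trans ha.1
      have hb0 : 0 < b := ha0.trans hb.1
      have hbI : b ∈ Ioo pstar 1 := ⟨ha.1.trans hb.1, hb.2⟩
      obtain ⟨hφab, c, hc, h⟩ := hcauchy ha0 hb.1 hb.2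
      have hcb := hrdown ⟨ha.1.trans hc.1, hc.2.trans hb.2⟩ hbI hc.2.le
      have hab := hrdown ha hbI hb.1.le
      rw [EReal.coe_le_coe_iff, hδ a ⟨ha0, ha.2⟩, hδ b ⟨hb0, hb.2⟩]
      have hφa := hφpos a ⟨ha0, ha.2⟩
      nlinarith [mul_le_mul_of_nonneg_right hcb (sub_nonneg.2 hφab.le),
        mul_le_mul_of_nonneg_left hab hφa.le]
    exact_mod_cast h1.trans hL
  have hW : ∀ p ∈ Ioo (0:ℝ) 1, 0 ≤ δ p → 0 ≤ ψ' p * φ p - ψ p * φ' p := by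
    intro p hp h
    have hpos := hφ'pos p hp
    have heq : ψ' p * φ p - ψ p * φ' p = δ p * φ' p := by
      rw [hδ p hp, hr p hp]
      field_simp
    rw [heq]
    exact mul_nonneg h hpos.le
  have hlsub : ∀ p ∈ Ioc 0 pstar, p ∈ Ioo (0:ℝ) 1 := fun p hp => ⟨hp.1, hp.2.trans_lt hp1⟩
  have hrsub : ∀ p ∈ Ico pstar 1, p ∈ Ioo (0:ℝ) 1 := fun p hp => ⟨hp0.trans_le hp.1, hp.2⟩
  have hl : MonotoneOn (fun t => ψ t / φ t) (Ioc 0 pstar) := by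
    refine monotoneOn_div_of_wronskian_nonneg (convex_Ioc _ _)
      (fun p hp => hφd p (hlsub p hp)) (fun p hp => hψd p (hlsub p hp))
      (fun p hp => (hφpos p (hlsub p hp)).ne') fun p hp => ?_
    rw [interior_Ioc] at hp
    exact hW p ⟨hp.1, hp.2.trans hp1⟩ (hδleft p hp)
  have hrt : MonotoneOn (fun t => ψ t / φ t) (Ico pstar 1) := by
    refine monotoneOn_div_of_wronskian_nonneg (convex_Ico _ _)
      (fun p hp => hφd p (hrsub p hp)) (fun p hp => hψd p (hrsub p hp))
      (fun p hp => (hφpos p (hrsub p hp)).ne') fun p hp => ?_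
    rw [interior_Ico] at hp
    exact hW p ⟨hp0.trans hp.1, hp.2⟩ (hδright p hp)
  rw [← Ioc_union_Ico_eq_Ioo hp0 hp1]
  exact hl.union_right hrt (isGreatest_Ioc hp0) (isLeast_Ico hp1)
end

section
/- Assume the unimodality hypothesis. If L₀ < 0 and L₁ ≥ 0, then there exists p₁ ∈ (0,1) such that the ratio p ↦ ψ(p)/φ(p) is monotone nonincreasing on (0,p₁) and monotone nondecreasing on (p₁,1). (Theorem 2.1, Case 3.) -/
open Set Filter Topology MeasureTheory intervalIntegral

/-- A strictly increasing function on `(0, 1)` with a nonnegative limit at `0` is positive. -/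
lemma pos_of_strictMonoOn_of_tendsto {φ : ℝ → ℝ} {l : ℝ} (hφ : StrictMonoOn φ (Ioo 0 1))
    (hl : Tendsto φ (𝓝[>] (0:ℝ)) (𝓝 l)) (hl0 : 0 ≤ l) {p : ℝ} (hp : p ∈ Ioo (0:ℝ) 1) :
    0 < φ p := by
  have hp2 : p / 2 ∈ Ioo (0:ℝ) 1 := ⟨by linarith [hp.1], by linarith [hp.1, hp.2]⟩
  have hle : l ≤ φ (p / 2) := by
    refine le_of_tendsto hl ?_
    filter_upwards [Ioo_mem_nhdsGT hp2.1] with q hq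
    exact (hφ ⟨hq.1, hq.2.trans hp2.2⟩ hp2 hq.2).le
  linarith [hφ hp2 hp (by linarith [hp.1])]

/-- Cauchy's mean value theorem for the increment of `φ * (ψ' / φ') - ψ`. -/
lemma exists_sub_eq_of_hasDerivAt_ratio {φ ψ φ' ψ' r δ : ℝ → ℝ} {s : Set ℝ} (hs : s.OrdConnected)
    (hφ : ∀ p ∈ s, HasDerivAt φ (φ' p) p) (hψ : ∀ p ∈ s, HasDerivAt ψ (ψ' p) p)
    (hφ' : ∀ p ∈ s, 0 < φ' p) (hr : ∀ p ∈ s, r p = ψ' p / φ' p)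
    (hδ : ∀ p ∈ s, δ p = φ p * r p - ψ p) {a b : ℝ} (ha : a ∈ s) (hb : b ∈ s) (hab : a < b) :
    ∃ c ∈ Ioo a b, δ b - δ a = φ b * (r b - r c) + φ a * (r c - r a) := by
  have hsub : Icc a b ⊆ s := hs.out ha hb
  obtain ⟨c, hc, h⟩ := exists_ratio_hasDerivAt_eq_ratio_slope φ φ' hab
    (fun x hx => (hφ x (hsub hx)).continuousAt.continuousWithinAt)
    (fun x hx => hφ x (hsub (Ioo_subset_Icc_self hx))) ψ ψ'
    (fun x hx => (hψ x (hsub hx)).continuousAt.continuousWithinAt)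
    (fun x hx => hψ x (hsub (Ioo_subset_Icc_self hx)))
  have hcs := hsub (Ioo_subset_Icc_self hc)
  have hrc : r c * φ' c = ψ' c := by rw [hr c hcs, div_mul_cancel₀ _ (hφ' c hcs).ne']
  have hinc : ψ b - ψ a = r c * (φ b - φ a) := by
    refine mul_right_cancel₀ (hφ' c hcs).ne' ?_
    rw [h, ← hrc]
    ring
  refine ⟨c, hc, ?_⟩
  rw [hδ a ha, hδ b hb]
  linear_combination -hinc

/-- The derivative of `ψ / φ` is a positive multiple of `φ * (ψ' / φ') - ψ`. -/
lemma hasDerivAt_div_of_ratio {φ ψ : ℝ → ℝ} {p φp ψp : ℝ} (hφ : HasDerivAt φ φp p)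
    (hψ : HasDerivAt ψ ψp p) (h0 : φ p ≠ 0) (hφp : φp ≠ 0) :
    HasDerivAt (fun t => ψ t / φ t) (φp / φ p ^ 2 * (φ p * (ψp / φp) - ψ p)) p := by
  have h : φp / φ p ^ 2 * (φ p * (ψp / φp) - ψ p) = (ψp * φ p - ψ p * φp) / φ p ^ 2 := by
    field_simp
  rw [h]
  exact hψ.fun_div hφ h0

theorem stmt6
    (φ ψ φ' ψ' r δ : ℝ → ℝ)
    (hφd : ∀ p ∈ Ioo (0:ℝ) 1, HasDerivAt φ (φ' p) p)
    (hψd : ∀ p ∈ Ioo (0:ℝ) 1, HasDerivAt ψ (ψ' p) p)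
    (hφ'pos : ∀ p ∈ Ioo (0:ℝ) 1, 0 < φ' p)
    (hψ'pos : ∀ p ∈ Ioo (0:ℝ) 1, 0 < ψ' p)
    (hr : ∀ p ∈ Ioo (0:ℝ) 1, r p = ψ' p / φ' p)
    (hrc : ContinuousOn r (Ioo 0 1))
    (lX lY : ℝ)
    (hlX : Tendsto φ (𝓝[>] (0:ℝ)) (𝓝 lX))
    (hlY : Tendsto ψ (𝓝[>] (0:ℝ)) (𝓝 lY))
    (hlX0 : 0 ≤ lX) (hlY0 : 0 ≤ lY)
    (hδ : ∀ p ∈ Ioo (0:ℝ) 1, δ p = φ p * r p - ψ p)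
    (pstar : ℝ) (hpstar : pstar ∈ Ioo (0:ℝ) 1)
    (hrup : MonotoneOn r (Ioo 0 pstar))
    (hrdown : AntitoneOn r (Ioo pstar 1))
    (L₀ L₁ : EReal)
    (hL₀ : Tendsto (fun q => (δ q : EReal)) (𝓝[>] (0:ℝ)) (𝓝 L₀))
    (hL₁ : Tendsto (fun q => (δ q : EReal)) (𝓝[<] (1:ℝ)) (𝓝 L₁))
    (h0 : L₀ < 0) (h1 : 0 ≤ L₁) :
    ∃ p₁ ∈ Ioo (0:ℝ) 1,
      AntitoneOn (fun t => ψ t / φ t) (Ioo 0 p₁) ∧ MonotoneOn (fun t => ψ t / φ t) (Ioo p₁ 1) := by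
  have hφmono : StrictMonoOn φ (Ioo 0 1) := by
    refine strictMonoOn_of_deriv_pos (convex_Ioo 0 1)
      (fun x hx => (hφd x hx).continuousAt.continuousWithinAt) fun x hx => ?_
    rw [interior_Ioo] at hx
    rw [(hφd x hx).deriv]
    exact hφ'pos x hx
  have hφpos : ∀ p ∈ Ioo (0:ℝ) 1, 0 < φ p := fun p hp =>
    pos_of_strictMonoOn_of_tendsto hφmono hlX hlX0 hp
  have hinc := fun {a b : ℝ} => exists_sub_eq_of_hasDerivAt_ratio (a := a) (b := b)
    ordConnected_Ioo hφd hψd hφ'pos hr hδ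
  have hδup : MonotoneOn δ (Ioo 0 pstar) := by
    intro a ha b hb hab
    rcases hab.eq_or_lt with rfl | hab
    · rfl
    have ha' : a ∈ Ioo (0:ℝ) 1 := ⟨ha.1, ha.2.trans hpstar.2⟩
    have hb' : b ∈ Ioo (0:ℝ) 1 := ⟨hb.1, hb.2.trans hpstar.2⟩
    obtain ⟨c, hc, h⟩ := hinc ha' hb' hab
    have hc' : c ∈ Ioo 0 pstar := ⟨ha.1.trans hc.1, hc.2.trans hb.2⟩
    have h₁ := mul_nonneg (hφpos b hb').le (sub_nonneg.2 (hrup hc' hb hc.2.le))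
    have h₂ := mul_nonneg (hφpos a ha').le (sub_nonneg.2 (hrup ha hc' hc.1.le))
    linarith
  have hδdown : AntitoneOn δ (Ioo pstar 1) := by
    intro a ha b hb hab
    rcases hab.eq_or_lt with rfl | hab
    · rfl
    have ha' : a ∈ Ioo (0:ℝ) 1 := ⟨hpstar.1.trans ha.1, ha.2⟩
    have hb' : b ∈ Ioo (0:ℝ) 1 := ⟨hpstar.1.trans hb.1, hb.2⟩
    obtain ⟨c, hc, h⟩ := hinc ha' hb' hab
    have hc' : c ∈ Ioo pstar 1 := ⟨ha.1.trans hc.1, hc.2.trans hb.2⟩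
    have h₁ := mul_nonneg (hφpos b hb').le (sub_nonneg.2 (hrdown hc' hb hc.2.le))
    have h₂ := mul_nonneg (hφpos a ha').le (sub_nonneg.2 (hrdown ha hc' hc.1.le))
    linarith
  have hδright : ∀ p ∈ Ioo pstar 1, 0 ≤ δ p := by
    intro p hp
    have hle : L₁ ≤ (δ p : EReal) := by
      refine le_of_tendsto hL₁ ?_
      filter_upwards [Ioo_mem_nhdsLT hp.2] with q hq
      exact EReal.coe_le_coe_iff.2 (hδdown hp ⟨hp.1.trans hq.1, hq.2⟩ hq.1.le)
    exact EReal.coe_nonneg.1 (h1.trans hle)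
  have hδstar : 0 ≤ δ pstar := by
    have hcont : ContinuousAt (fun p => φ p * r p - ψ p) pstar :=
      ((hφd _ hpstar).continuousAt.mul (hrc.continuousAt (isOpen_Ioo.mem_nhds hpstar))).sub
        (hψd _ hpstar).continuousAt
    rw [hδ _ hpstar]
    refine ge_of_tendsto (hcont.tendsto.mono_left (nhdsWithin_le_nhds (s := Ioi pstar))) ?_
    filter_upwards [Ioo_mem_nhdsGT hpstar.2] with q hq
    rw [← hδ q ⟨hpstar.1.trans hq.1, hq.2⟩]
    exact hδright q hq
  set S : Set ℝ := {p ∈ Ioo 0 pstar | δ p < 0}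
  obtain ⟨s₀, hs₀⟩ : S.Nonempty := by
    have hev : ∀ᶠ q in 𝓝[>] (0:ℝ), (δ q : EReal) < 0 := hL₀.eventually (gt_mem_nhds h0)
    obtain ⟨q, hq, hqS⟩ := (hev.and (Ioo_mem_nhdsGT hpstar.1)).exists
    exact ⟨q, hqS, EReal.coe_neg'.1 hq⟩
  have hbdd : BddAbove S := ⟨pstar, fun x hx => hx.1.2.le⟩
  have hp₁pos : 0 < sSup S := hs₀.1.1.trans_le (le_csSup hbdd hs₀)
  have hp₁le : sSup S ≤ pstar := csSup_le ⟨s₀, hs₀⟩ fun x hx => hx.1.2.le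
  have hp₁lt : sSup S < 1 := hp₁le.trans_lt hpstar.2
  have hneg : ∀ p ∈ Ioo 0 (sSup S), δ p ≤ 0 := by
    intro p hp
    obtain ⟨s, hs, hps⟩ := exists_lt_of_lt_csSup ⟨s₀, hs₀⟩ hp.2
    exact (hδup ⟨hp.1, hps.trans hs.1.2⟩ hs.1 hps.le).trans hs.2.le
  have hnonneg : ∀ p ∈ Ioo (sSup S) 1, 0 ≤ δ p := by
    intro p hp
    rcases lt_trichotomy p pstar with h | rfl | h
    · by_contra! hlt
      exact (le_csSup hbdd (show p ∈ S from ⟨⟨hp₁pos.trans hp.1, h⟩, hlt⟩)).not_gt hp.1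
    · exact hδstar
    · exact hδright p ⟨h, hp.2⟩
  have hderiv : ∀ p ∈ Ioo (0:ℝ) 1,
      HasDerivAt (fun t => ψ t / φ t) (φ' p / φ p ^ 2 * δ p) p := by
    intro p hp
    rw [hδ p hp, hr p hp]
    exact hasDerivAt_div_of_ratio (hφd p hp) (hψd p hp) (hφpos p hp).ne' (hφ'pos p hp).ne'
  have hcoef : ∀ p ∈ Ioo (0:ℝ) 1, 0 ≤ φ' p / φ p ^ 2 := fun p hp =>
    div_nonneg (hφ'pos p hp).le (sq_nonneg _)
  have hleft : Ioo 0 (sSup S) ⊆ Ioo 0 1 := Ioo_subset_Ioo_right hp₁lt.le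
  have hright : Ioo (sSup S) 1 ⊆ Ioo 0 1 := Ioo_subset_Ioo_left hp₁pos.le
  refine ⟨sSup S, ⟨hp₁pos, hp₁lt⟩, ?_, ?_⟩
  · refine antitoneOn_of_hasDerivWithinAt_nonpos (f' := fun p => φ' p / φ p ^ 2 * δ p)
      (convex_Ioo _ _)
      (fun x hx => (hderiv x (hleft hx)).continuousAt.continuousWithinAt) ?_ ?_ <;>
      rw [interior_Ioo] <;> intro x hx
    · exact (hderiv x (hleft hx)).hasDerivWithinAt
    · exact mul_nonpos_of_nonneg_of_nonpos (hcoef x (hleft hx)) (hneg x hx)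
  · refine monotoneOn_of_hasDerivWithinAt_nonneg (f' := fun p => φ' p / φ p ^ 2 * δ p)
      (convex_Ioo _ _)
      (fun x hx => (hderiv x (hright hx)).continuousAt.continuousWithinAt) ?_ ?_ <;>
      rw [interior_Ioo] <;> intro x hx
    · exact (hderiv x (hright hx)).hasDerivWithinAt
    · exact mul_nonneg (hcoef x (hright hx)) (hnonneg x hx)
end

section
/- Assume the unimodality hypothesis. Then X ≤_* Y — i.e., p ↦ ψ(p)/φ(p) is monotone nondecreasing on (0,1) — if and only if L₀ ≥ 0 and L₁ ≥ 0. (Theorem 2.2, part 1.) -/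
open Set Filter Topology MeasureTheory intervalIntegral

/-- Cauchy's mean value theorem, in terms of the quotient of the derivatives. -/
theorem exists_sub_eq_div_deriv_mul_sub {φ ψ φ' ψ' : ℝ → ℝ} {s t : ℝ} (hst : s < t)
    (hφ : ∀ p ∈ Icc s t, HasDerivAt φ (φ' p) p) (hψ : ∀ p ∈ Icc s t, HasDerivAt ψ (ψ' p) p)
    (hφ' : ∀ p ∈ Icc s t, φ' p ≠ 0) :
    ∃ c ∈ Ioo s t, ψ t - ψ s = ψ' c / φ' c * (φ t - φ s) := by
  obtain ⟨c, hc, h⟩ := exists_ratio_hasDerivAt_eq_ratio_slope φ φ' hst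
    (fun p hp => (hφ p hp).continuousAt.continuousWithinAt)
    (fun p hp => hφ p (Ioo_subset_Icc_self hp)) ψ ψ'
    (fun p hp => (hψ p hp).continuousAt.continuousWithinAt)
    (fun p hp => hψ p (Ioo_subset_Icc_self hp))
  have hne := hφ' c (Ioo_subset_Icc_self hc)
  refine ⟨c, hc, ?_⟩
  field_simp
  linarith

/-- A function with positive derivative on an interval `Ioo a b` exceeds its right limit at `a`. -/
theorem lt_of_tendsto_of_deriv_pos {φ φ' : ℝ → ℝ} {a b l : ℝ}
    (hφ : ∀ p ∈ Ioo a b, HasDerivAt φ (φ' p) p) (hφ' : ∀ p ∈ Ioo a b, 0 < φ' p)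
    (hl : Tendsto φ (𝓝[>] a) (𝓝 l)) {p : ℝ} (hp : p ∈ Ioo a b) : l < φ p := by
  have hmono : StrictMonoOn φ (Ioo a b) := by
    refine strictMonoOn_of_deriv_pos (convex_Ioo a b)
      (fun q hq => (hφ q hq).continuousAt.continuousWithinAt) fun q hq => ?_
    rw [interior_Ioo] at hq
    rw [(hφ q hq).deriv]
    exact hφ' q hq
  obtain ⟨q, haq, hqp⟩ := exists_between hp.1
  have hq : q ∈ Ioo a b := ⟨haq, hqp.trans hp.2⟩
  refine lt_of_le_of_lt (le_of_tendsto hl ?_) (hmono hq hp hqp)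
  filter_upwards [Ioo_mem_nhdsGT haq] with x hx
  exact hmono.monotoneOn ⟨hx.1, hx.2.trans hq.2⟩ hq hx.2.le

/-- A quotient of differentiable functions is monotone exactly when its Wronskian is
nonnegative. -/
theorem monotoneOn_div_iff_wronskian_nonneg {φ ψ φ' ψ' : ℝ → ℝ} {a b : ℝ}
    (hφ : ∀ p ∈ Ioo a b, HasDerivAt φ (φ' p) p) (hψ : ∀ p ∈ Ioo a b, HasDerivAt ψ (ψ' p) p)
    (hpos : ∀ p ∈ Ioo a b, 0 < φ p) :
    MonotoneOn (fun t => ψ t / φ t) (Ioo a b) ↔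
      ∀ p ∈ Ioo a b, 0 ≤ ψ' p * φ p - ψ p * φ' p := by
  have hd : ∀ p ∈ Ioo a b,
      HasDerivAt (fun t => ψ t / φ t) ((ψ' p * φ p - ψ p * φ' p) / φ p ^ 2) p :=
    fun p hp => (hψ p hp).div (hφ p hp) (hpos p hp).ne'
  constructor
  · intro h p hp
    have h0 := h.derivWithin_nonneg (x := p)
    rw [derivWithin_of_isOpen isOpen_Ioo hp, (hd p hp).deriv] at h0
    have h2 : 0 < φ p ^ 2 := pow_pos (hpos p hp) 2
    simpa using (le_div_iff₀ h2).1 h0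
  · intro h
    refine monotoneOn_of_deriv_nonneg (convex_Ioo a b)
      (fun p hp => (hd p hp).continuousAt.continuousWithinAt)
      (fun p hp => ?_) fun p hp => ?_
    all_goals rw [interior_Ioo] at hp
    · exact (hd p hp).differentiableAt.differentiableWithinAt
    · rw [(hd p hp).deriv]
      exact div_nonneg (h p hp) (sq_nonneg _)

section DerivRatio

variable {φ ψ φ' ψ' r : ℝ → ℝ} {a b : ℝ}

/-- If `r = ψ' / φ'` is nondecreasing, then so is `φ * r - ψ`. -/
theorem monotoneOn_mul_sub_of_monotoneOn_div_deriv
    (hφ : ∀ p ∈ Ioo a b, HasDerivAt φ (φ' p) p) (hψ : ∀ p ∈ Ioo a b, HasDerivAt ψ (ψ' p) p)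
    (hφ' : ∀ p ∈ Ioo a b, 0 < φ' p) (hpos : ∀ p ∈ Ioo a b, 0 < φ p)
    (hr : ∀ p ∈ Ioo a b, r p = ψ' p / φ' p) (hmono : MonotoneOn r (Ioo a b)) :
    MonotoneOn (fun p => φ p * r p - ψ p) (Ioo a b) := by
  intro s hs t ht hst
  rcases hst.eq_or_lt with rfl | hst
  · exact le_rfl
  have hsub : Icc s t ⊆ Ioo a b := Icc_subset_Ioo hs.1 ht.2
  obtain ⟨c, hc, h⟩ := exists_sub_eq_div_deriv_mul_sub hst (fun p hp => hφ p (hsub hp))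
    (fun p hp => hψ p (hsub hp)) (fun p hp => (hφ' p (hsub hp)).ne')
  obtain ⟨d, hd, hφd⟩ := exists_hasDerivAt_eq_slope φ φ' hst
    (fun p hp => (hφ p (hsub hp)).continuousAt.continuousWithinAt)
    (fun p hp => hφ p (hsub (Ioo_subset_Icc_self hp)))
  have hφst : 0 < φ t - φ s := by
    have h0 := hφ' d (hsub (Ioo_subset_Icc_self hd))
    rw [hφd] at h0
    exact (div_pos_iff_of_pos_right (sub_pos.2 hst)).1 h0
  have hcI := hsub (Ioo_subset_Icc_self hc)
  rw [← hr c hcI] at h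
  have h1 := mul_le_mul_of_nonneg_right (hmono hcI ht hc.2.le) hφst.le
  have h2 := mul_le_mul_of_nonneg_left (hmono hs ht hst.le) (hpos s hs).le
  dsimp only
  linarith

/-- If `r = ψ' / φ'` is nonincreasing, then so is `φ * r - ψ`. -/
theorem antitoneOn_mul_sub_of_antitoneOn_div_deriv
    (hφ : ∀ p ∈ Ioo a b, HasDerivAt φ (φ' p) p) (hψ : ∀ p ∈ Ioo a b, HasDerivAt ψ (ψ' p) p)
    (hφ' : ∀ p ∈ Ioo a b, 0 < φ' p) (hpos : ∀ p ∈ Ioo a b, 0 < φ p)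
    (hr : ∀ p ∈ Ioo a b, r p = ψ' p / φ' p) (hanti : AntitoneOn r (Ioo a b)) :
    AntitoneOn (fun p => φ p * r p - ψ p) (Ioo a b) := by
  have h := monotoneOn_mul_sub_of_monotoneOn_div_deriv (ψ := fun p => -ψ p)
    (ψ' := fun p => -ψ' p) (r := fun p => -r p) hφ (fun p hp => (hψ p hp).neg) hφ' hpos
    (fun p hp => by rw [hr p hp, neg_div]) hanti.neg
  intro s hs t ht hst
  have := h hs ht hst
  dsimp only at this ⊢
  linarith

end DerivRatio

theorem stmt9
    (φ ψ φ' ψ' r δ : ℝ → ℝ)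
    (hφd : ∀ p ∈ Ioo (0:ℝ) 1, HasDerivAt φ (φ' p) p)
    (hψd : ∀ p ∈ Ioo (0:ℝ) 1, HasDerivAt ψ (ψ' p) p)
    (hφ'pos : ∀ p ∈ Ioo (0:ℝ) 1, 0 < φ' p)
    (hψ'pos : ∀ p ∈ Ioo (0:ℝ) 1, 0 < ψ' p)
    (hr : ∀ p ∈ Ioo (0:ℝ) 1, r p = ψ' p / φ' p)
    (hrc : ContinuousOn r (Ioo 0 1))
    (lX lY : ℝ)
    (hlX : Tendsto φ (𝓝[>] (0:ℝ)) (𝓝 lX))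
    (hlY : Tendsto ψ (𝓝[>] (0:ℝ)) (𝓝 lY))
    (hlX0 : 0 ≤ lX) (hlY0 : 0 ≤ lY)
    (hδ : ∀ p ∈ Ioo (0:ℝ) 1, δ p = φ p * r p - ψ p)
    (pstar : ℝ) (hpstar : pstar ∈ Ioo (0:ℝ) 1)
    (hrup : MonotoneOn r (Ioo 0 pstar))
    (hrdown : AntitoneOn r (Ioo pstar 1))
    (L₀ L₁ : EReal)
    (hL₀ : Tendsto (fun q => (δ q : EReal)) (𝓝[>] (0:ℝ)) (𝓝 L₀))
    (hL₁ : Tendsto (fun q => (δ q : EReal)) (𝓝[<] (1:ℝ)) (𝓝 L₁))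
 :
    MonotoneOn (fun t => ψ t / φ t) (Ioo 0 1) ↔ (0 ≤ L₀ ∧ 0 ≤ L₁) := by
  have hφpos : ∀ p ∈ Ioo (0:ℝ) 1, 0 < φ p := fun p hp =>
    hlX0.trans_lt (lt_of_tendsto_of_deriv_pos hφd hφ'pos hlX hp)
  have hwronskian : ∀ p ∈ Ioo (0:ℝ) 1, ψ' p * φ p - ψ p * φ' p = φ' p * δ p := by
    intro p hp
    have hne := (hφ'pos p hp).ne'
    rw [hδ p hp, hr p hp]
    field_simp
  have hiff : MonotoneOn (fun t => ψ t / φ t) (Ioo 0 1) ↔ ∀ p ∈ Ioo (0:ℝ) 1, 0 ≤ δ p := by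
    rw [monotoneOn_div_iff_wronskian_nonneg hφd hψd hφpos]
    refine forall₂_congr fun p hp => ?_
    rw [hwronskian p hp, mul_nonneg_iff_of_pos_left (hφ'pos p hp)]
  rw [hiff]
  constructor
  · intro h
    constructor
    · refine ge_of_tendsto hL₀ ?_
      filter_upwards [Ioo_mem_nhdsGT zero_lt_one] with q hq
      exact_mod_cast h q hq
    · refine ge_of_tendsto hL₁ ?_
      filter_upwards [Ioo_mem_nhdsLT zero_lt_one] with q hq
      exact_mod_cast h q hq
  · rintro ⟨h0, h1⟩
    have hsubl : Ioo 0 pstar ⊆ Ioo (0:ℝ) 1 := Ioo_subset_Ioo_right hpstar.2.le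
    have hsubr : Ioo pstar 1 ⊆ Ioo (0:ℝ) 1 := Ioo_subset_Ioo_left hpstar.1.le
    have hδup : MonotoneOn δ (Ioo 0 pstar) :=
      (monotoneOn_mul_sub_of_monotoneOn_div_deriv (fun p hp => hφd p (hsubl hp))
        (fun p hp => hψd p (hsubl hp)) (fun p hp => hφ'pos p (hsubl hp))
        (fun p hp => hφpos p (hsubl hp)) (fun p hp => hr p (hsubl hp)) hrup).congr
        fun p hp => (hδ p (hsubl hp)).symm
    have hδdown : AntitoneOn δ (Ioo pstar 1) :=
      (antitoneOn_mul_sub_of_antitoneOn_div_deriv (fun p hp => hφd p (hsubr hp))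
        (fun p hp => hψd p (hsubr hp)) (fun p hp => hφ'pos p (hsubr hp))
        (fun p hp => hφpos p (hsubr hp)) (fun p hp => hr p (hsubr hp)) hrdown).congr
        fun p hp => (hδ p (hsubr hp)).symm
    have hleft : ∀ p ∈ Ioo 0 pstar, 0 ≤ δ p := by
      intro p hp
      have h : L₀ ≤ (δ p : EReal) := by
        refine le_of_tendsto hL₀ ?_
        filter_upwards [Ioo_mem_nhdsGT hp.1] with q hq
        exact_mod_cast hδup ⟨hq.1, hq.2.trans hp.2⟩ hp hq.2.le
      exact_mod_cast h0.trans h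
    have hright : ∀ p ∈ Ioo pstar 1, 0 ≤ δ p := by
      intro p hp
      have h : L₁ ≤ (δ p : EReal) := by
        refine le_of_tendsto hL₁ ?_
        filter_upwards [Ioo_mem_nhdsLT hp.2] with q hq
        exact_mod_cast hδdown hp ⟨hp.1.trans hq.1, hq.2⟩ hq.1.le
      exact_mod_cast h1.trans h
    intro p hp
    rcases lt_trichotomy p pstar with hlt | rfl | hgt
    · exact hleft p ⟨hp.1, hlt⟩
    · have hcont : ContinuousAt (fun q => φ q * r q - ψ q) p :=
        ((hφd p hp).continuousAt.mul (hrc.continuousAt (isOpen_Ioo.mem_nhds hp))).sub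
          (hψd p hp).continuousAt
      rw [hδ p hp]
      refine ge_of_tendsto (hcont.tendsto.mono_left (nhdsWithin_le_nhds (s := Iio p))) ?_
      filter_upwards [Ioo_mem_nhdsLT hp.1] with q hq
      rw [← hδ q (hsubl hq)]
      exact hleft q hq
    · exact hright p ⟨hgt, hp.2⟩
end

section
/- Assume the unimodality hypothesis and suppose L₀ < 0 and L₁ ≥ 0. Then X ≤_ps Y if and only if l_X/E[X] − l_Y/E[Y] ≥ 0 (equivalently, lim_{p→0⁺} (φ(p)/E[X] − ψ(p)/E[Y]) ≥ 0). (Theorem on the expected proportional shortfall order, part 1.) -/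
open Set Filter Topology MeasureTheory intervalIntegral

/-- A strictly increasing function on `(0, 1)` with a nonnegative limit at `0` is positive. -/
theorem StrictMonoOn.pos_of_tendsto_zero {f : ℝ → ℝ} {l : ℝ} (hf : StrictMonoOn f (Ioo 0 1))
    (hl : Tendsto f (𝓝[>] (0:ℝ)) (𝓝 l)) (hl0 : 0 ≤ l) {p : ℝ} (hp : p ∈ Ioo (0:ℝ) 1) :
    0 < f p := by
  have hm : p / 2 ∈ Ioo (0:ℝ) 1 := ⟨by linarith [hp.1], by linarith [hp.1, hp.2]⟩
  have h1 : l ≤ f (p / 2) := by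
    refine le_of_tendsto hl ?_
    filter_upwards [Ioo_mem_nhdsGT hm.1] with x hx
    exact (hf ⟨hx.1, hx.2.trans hm.2⟩ hm hx.2).le
  have h2 : f (p / 2) < f p := hf hm hp (by linarith [hp.1])
  linarith

/-- If the derivative of `f / g` is nonnegative, then `f / g` increases. -/
theorem mul_le_mul_of_hasDerivAt_div {f g f' g' : ℝ → ℝ} {a b : ℝ} (hab : a ≤ b)
    (hf : ∀ x ∈ Icc a b, HasDerivAt f (f' x) x) (hg : ∀ x ∈ Icc a b, HasDerivAt g (g' x) x)
    (hg0 : ∀ x ∈ Icc a b, 0 < g x) (h : ∀ x ∈ Ioo a b, f x * g' x ≤ f' x * g x) :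
    f a * g b ≤ f b * g a := by
  have hd : ∀ x ∈ Icc a b,
      HasDerivAt (fun y => f y / g y) ((f' x * g x - f x * g' x) / g x ^ 2) x :=
    fun x hx => (hf x hx).div (hg x hx) (hg0 x hx).ne'
  have hmono : MonotoneOn (fun y => f y / g y) (Icc a b) := by
    refine monotoneOn_of_deriv_nonneg (convex_Icc a b)
      (fun x hx => (hd x hx).continuousAt.continuousWithinAt) (fun x hx => ?_) fun x hx => ?_
    · exact (hd x (interior_subset hx)).differentiableAt.differentiableWithinAt
    · rw [(hd x (interior_subset hx)).deriv]
      rw [interior_Icc] at hx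
      exact div_nonneg (sub_nonneg.2 (h x hx)) (sq_nonneg _)
  have := hmono (left_mem_Icc.2 hab) (right_mem_Icc.2 hab) hab
  exact (div_le_div_iff₀ (hg0 a (left_mem_Icc.2 hab)) (hg0 b (right_mem_Icc.2 hab))).1 this

/-- Cauchy's mean value theorem with an explicit ratio of derivatives. -/
theorem exists_sub_eq_ratio_mul_sub_s11 {f g f' g' r : ℝ → ℝ} {a b : ℝ} (hab : a < b)
    (hf : ∀ x ∈ Icc a b, HasDerivAt f (f' x) x) (hg : ∀ x ∈ Icc a b, HasDerivAt g (g' x) x)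
    (hf' : ∀ x ∈ Icc a b, 0 < f' x) (hr : ∀ x ∈ Icc a b, r x = g' x / f' x) :
    ∃ c ∈ Ioo a b, g b - g a = r c * (f b - f a) := by
  obtain ⟨c, hc, h⟩ := exists_ratio_hasDerivAt_eq_ratio_slope f f' hab
    (fun x hx => (hf x hx).continuousAt.continuousWithinAt)
    (fun x hx => hf x (Ioo_subset_Icc_self hx)) g g'
    (fun x hx => (hg x hx).continuousAt.continuousWithinAt)
    (fun x hx => hg x (Ioo_subset_Icc_self hx))
  refine ⟨c, hc, ?_⟩
  have hc' := hf' c (Ioo_subset_Icc_self hc)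
  rw [hr c (Ioo_subset_Icc_self hc)]
  field_simp
  linarith

/-- The expected proportional shortfall comparison at a point, with denominators cleared. -/
theorem shortfall_le_shortfall_iff {f g : ℝ → ℝ} {p : ℝ}
    (hf : IntervalIntegrable f volume p 1) (hg : IntervalIntegrable g volume p 1)
    (hfp : 0 < f p) (hgp : 0 < g p) :
    (∫ q in p..(1:ℝ), (f q - f p)) / f p ≤ (∫ q in p..(1:ℝ), (g q - g p)) / g p ↔
      g p * ∫ q in p..(1:ℝ), f q ≤ f p * ∫ q in p..(1:ℝ), g q := by
  rw [integral_sub hf intervalIntegrable_const, integral_sub hg intervalIntegrable_const,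
    intervalIntegral.integral_const, intervalIntegral.integral_const, div_le_div_iff₀ hfp hgp, smul_eq_mul, smul_eq_mul]
  constructor <;> intro h <;> nlinarith

theorem tendsto_integral_zero_right {f : ℝ → ℝ} (hf : IntervalIntegrable f volume 0 1) :
    Tendsto (fun p => ∫ q in p..(1:ℝ), f q) (𝓝[>] (0:ℝ)) (𝓝 (∫ q in (0:ℝ)..1, f q)) := by
  have h := continuousOn_primitive_interval_left
    (((intervalIntegrable_iff' (by simp)).1 hf))
  rw [uIcc_of_le zero_le_one] at h
  refine (h 0 (left_mem_Icc.2 zero_le_one)).tendsto.mono_left ?_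
  exact nhdsWithin_le_of_mem (Icc_mem_nhdsGT zero_lt_one)

theorem stmt11
    (φ ψ φ' ψ' r δ : ℝ → ℝ)
    (hφd : ∀ p ∈ Ioo (0:ℝ) 1, HasDerivAt φ (φ' p) p)
    (hψd : ∀ p ∈ Ioo (0:ℝ) 1, HasDerivAt ψ (ψ' p) p)
    (hφ'pos : ∀ p ∈ Ioo (0:ℝ) 1, 0 < φ' p)
    (hψ'pos : ∀ p ∈ Ioo (0:ℝ) 1, 0 < ψ' p)
    (hr : ∀ p ∈ Ioo (0:ℝ) 1, r p = ψ' p / φ' p)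
    (hrc : ContinuousOn r (Ioo 0 1))
    (lX lY : ℝ)
    (hlX : Tendsto φ (𝓝[>] (0:ℝ)) (𝓝 lX))
    (hlY : Tendsto ψ (𝓝[>] (0:ℝ)) (𝓝 lY))
    (hlX0 : 0 ≤ lX) (hlY0 : 0 ≤ lY)
    (hδ : ∀ p ∈ Ioo (0:ℝ) 1, δ p = φ p * r p - ψ p)
    (pstar : ℝ) (hpstar : pstar ∈ Ioo (0:ℝ) 1)
    (hrup : MonotoneOn r (Ioo 0 pstar))
    (hrdown : AntitoneOn r (Ioo pstar 1))
    (L₀ L₁ : EReal)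
    (hL₀ : Tendsto (fun q => (δ q : EReal)) (𝓝[>] (0:ℝ)) (𝓝 L₀))
    (hL₁ : Tendsto (fun q => (δ q : EReal)) (𝓝[<] (1:ℝ)) (𝓝 L₁))
    (hφint : IntervalIntegrable φ volume 0 1)
    (hψint : IntervalIntegrable ψ volume 0 1)
    (EX EY : ℝ)
    (hEX : EX = ∫ q in (0:ℝ)..1, φ q) (hEY : EY = ∫ q in (0:ℝ)..1, ψ q)
    (hEXpos : 0 < EX) (hEYpos : 0 < EY)
    (EPSX EPSY : ℝ → ℝ)
    (hEPSX : ∀ p ∈ Ioo (0:ℝ) 1, EPSX p = (∫ q in p..(1:ℝ), (φ q - φ p)) / φ p)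
    (hEPSY : ∀ p ∈ Ioo (0:ℝ) 1, EPSY p = (∫ q in p..(1:ℝ), (ψ q - ψ p)) / ψ p)
    (h0 : L₀ < 0) (h1 : 0 ≤ L₁) :
    (∀ p ∈ Ioo (0:ℝ) 1, EPSX p ≤ EPSY p) ↔ 0 ≤ lX / EX - lY / EY := by
  have hφm := strictMonoOn_Ioo_of_hasDerivAt_pos hφd hφ'pos
  have hψm := strictMonoOn_Ioo_of_hasDerivAt_pos hψd hψ'pos
  have hφ0 : ∀ p ∈ Ioo (0:ℝ) 1, 0 < φ p := fun p hp => hφm.pos_of_tendsto_zero hlX hlX0 hp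
  have hψ0 : ∀ p ∈ Ioo (0:ℝ) 1, 0 < ψ p := fun p hp => hψm.pos_of_tendsto_zero hlY hlY0 hp
  have hr0 : ∀ p ∈ Ioo (0:ℝ) 1, 0 < r p := fun p hp => by
    rw [hr p hp]
    exact div_pos (hψ'pos p hp) (hφ'pos p hp)
  have hIcc : ∀ {p q : ℝ}, p ∈ Ioo (0:ℝ) 1 → q ∈ Ioo (0:ℝ) 1 → Icc p q ⊆ Ioo (0:ℝ) 1 :=
    fun hp hq x hx => ⟨hp.1.trans_le hx.1, hx.2.trans_lt hq.2⟩
  have hφi : ∀ {p q : ℝ}, p ∈ Icc (0:ℝ) 1 → q ∈ Icc (0:ℝ) 1 →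
      IntervalIntegrable φ volume p q := fun hp hq =>
    hφint.mono_set (by rw [uIcc_of_le zero_le_one]; exact uIcc_subset_Icc hp hq)
  have hψi : ∀ {p q : ℝ}, p ∈ Icc (0:ℝ) 1 → q ∈ Icc (0:ℝ) 1 →
      IntervalIntegrable ψ volume p q := fun hp hq =>
    hψint.mono_set (by rw [uIcc_of_le zero_le_one]; exact uIcc_subset_Icc hp hq)
  have h0mem : (0:ℝ) ∈ Icc (0:ℝ) 1 := left_mem_Icc.2 zero_le_one
  have h1mem : (1:ℝ) ∈ Icc (0:ℝ) 1 := right_mem_Icc.2 zero_le_one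
  have hps : (∀ p ∈ Ioo (0:ℝ) 1, EPSX p ≤ EPSY p) ↔ ∀ p ∈ Ioo (0:ℝ) 1,
      ψ p * ∫ q in p..(1:ℝ), φ q ≤ φ p * ∫ q in p..(1:ℝ), ψ q := by
    refine forall₂_congr fun p hp => ?_
    have hp' := Ioo_subset_Icc_self hp
    rw [hEPSX p hp, hEPSY p hp]
    exact shortfall_le_shortfall_iff (hφi hp' h1mem) (hψi hp' h1mem) (hφ0 p hp) (hψ0 p hp)
  have hcond : 0 ≤ lX / EX - lY / EY ↔ lY * EX ≤ lX * EY := by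
    rw [sub_nonneg, div_le_div_iff₀ hEYpos hEXpos]
  rw [hps, hcond]
  constructor
  · intro h
    have hX := hlY.mul (tendsto_integral_zero_right hφint)
    have hY := hlX.mul (tendsto_integral_zero_right hψint)
    rw [← hEX] at hX
    rw [← hEY] at hY
    refine le_of_tendsto_of_tendsto hX hY ?_
    filter_upwards [Ioo_mem_nhdsGT (zero_lt_one' ℝ)] with p hp using h p hp
  intro hE p hp
  have hlYpos : 0 < lY := by
    have hlim : Tendsto (fun q => ((-ψ q : ℝ) : EReal)) (𝓝[>] (0:ℝ)) (𝓝 ((-lY : ℝ) : EReal)) :=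
      (continuous_coe_real_ereal.tendsto _).comp hlY.neg
    have hle : ((-lY : ℝ) : EReal) ≤ L₀ := by
      refine le_of_tendsto_of_tendsto hlim hL₀ ?_
      filter_upwards [Ioo_mem_nhdsGT (zero_lt_one' ℝ)] with q hq
      rw [EReal.coe_le_coe_iff, hδ q hq]
      linarith [mul_pos (hφ0 q hq) (hr0 q hq)]
    have := hle.trans_lt h0
    rw [← EReal.coe_zero, EReal.coe_lt_coe_iff] at this
    linarith
  have hlXpos : 0 < lX := pos_of_mul_pos_left ((mul_pos hlYpos hEXpos).trans_le hE) hEYpos.le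
  have hcauchy : ∀ {p q : ℝ}, p ∈ Ioo (0:ℝ) 1 → q ∈ Ioo (0:ℝ) 1 → p < q →
      ∃ c ∈ Ioo p q, ψ q - ψ p = r c * (φ q - φ p) := fun hp hq hpq =>
    exists_sub_eq_ratio_mul_sub_s11 hpq (fun x hx => hφd x (hIcc hp hq hx))
      (fun x hx => hψd x (hIcc hp hq hx)) (fun x hx => hφ'pos x (hIcc hp hq hx))
      (fun x hx => hr x (hIcc hp hq hx))
  have hδup : MonotoneOn δ (Ioo 0 pstar) := by
    refine monotoneOn_iff_forall_lt.2 fun x hx y hy hxy => ?_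
    have hx1 : x ∈ Ioo (0:ℝ) 1 := ⟨hx.1, hx.2.trans hpstar.2⟩
    have hy1 : y ∈ Ioo (0:ℝ) 1 := ⟨hy.1, hy.2.trans hpstar.2⟩
    obtain ⟨c, hc, hcxy⟩ := hcauchy hx1 hy1 hxy
    have hry : r c ≤ r y := hrup ⟨hx.1.trans hc.1, hc.2.trans hy.2⟩ hy hc.2.le
    have hrx : r x ≤ r y := hrup hx hy hxy.le
    rw [hδ x hx1, hδ y hy1]
    nlinarith [mul_nonneg (sub_nonneg.2 hry) (sub_nonneg.2 (hφm hx1 hy1 hxy).le),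
      mul_nonneg (sub_nonneg.2 hrx) (hφ0 x hx1).le]
  have hδdown : AntitoneOn δ (Ioo pstar 1) := by
    refine antitoneOn_iff_forall_lt.2 fun x hx y hy hxy => ?_
    have hx1 : x ∈ Ioo (0:ℝ) 1 := ⟨hpstar.1.trans hx.1, hx.2⟩
    have hy1 : y ∈ Ioo (0:ℝ) 1 := ⟨hpstar.1.trans hy.1, hy.2⟩
    obtain ⟨c, hc, hcxy⟩ := hcauchy hx1 hy1 hxy
    have hry : r y ≤ r c := hrdown ⟨hx.1.trans hc.1, hc.2.trans hy.2⟩ hy hc.2.le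
    have hrx : r y ≤ r x := hrdown hx hy hxy.le
    rw [hδ x hx1, hδ y hy1]
    nlinarith [mul_nonneg (sub_nonneg.2 hry) (sub_nonneg.2 (hφm hx1 hy1 hxy).le),
      mul_nonneg (sub_nonneg.2 hrx) (hφ0 x hx1).le]
  have hδright : ∀ q ∈ Ioo pstar 1, 0 ≤ δ q := by
    intro q hq
    have hle : L₁ ≤ (δ q : EReal) := by
      refine le_of_tendsto hL₁ ?_
      filter_upwards [Ioo_mem_nhdsLT hq.2] with x hx
      exact EReal.coe_le_coe_iff.2 (hδdown hq ⟨hq.1.trans hx.1, hx.2⟩ hx.1.le)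
    exact_mod_cast h1.trans hle
  have hδstar : 0 ≤ δ pstar := by
    have hrat : ContinuousAt r pstar := hrc.continuousAt (Ioo_mem_nhds hpstar.1 hpstar.2)
    have hlim : Tendsto (fun q => φ q * r q - ψ q) (𝓝[>] pstar) (𝓝 (δ pstar)) := by
      rw [hδ pstar hpstar]
      exact (((hφd pstar hpstar).continuousAt.mul hrat).sub
        (hψd pstar hpstar).continuousAt).tendsto.mono_left nhdsWithin_le_nhds
    refine ge_of_tendsto hlim ?_
    filter_upwards [Ioo_mem_nhdsGT hpstar.2] with q hq
    rw [← hδ q ⟨hpstar.1.trans hq.1, hq.2⟩]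
    exact hδright q hq
  have hδstay : ∀ x ∈ Ioo (0:ℝ) 1, ∀ y ∈ Ioo (0:ℝ) 1, x ≤ y → 0 ≤ δ x → 0 ≤ δ y := by
    intro x hx y hy hxy hx0
    rcases lt_trichotomy y pstar with h | h | h
    · exact hx0.trans (hδup ⟨hx.1, hxy.trans_lt h⟩ ⟨hy.1, h⟩ hxy)
    · rwa [h]
    · exact hδright y ⟨h, hy.2⟩
  have hδφ' : ∀ x ∈ Ioo (0:ℝ) 1, δ x * φ' x = ψ' x * φ x - ψ x * φ' x := by
    intro x hx
    have := (hφ'pos x hx).ne'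
    rw [hδ x hx, hr x hx]
    field_simp
  rcases le_or_gt 0 (δ p) with hp0 | hp0
  · have hle : ∀ q ∈ Ioo p 1, ψ p * φ q ≤ φ p * ψ q := by
      intro q hq
      have hq1 : q ∈ Ioo (0:ℝ) 1 := ⟨hp.1.trans hq.1, hq.2⟩
      have hsub := hIcc hp hq1
      rw [mul_comm (φ p)]
      refine mul_le_mul_of_hasDerivAt_div hq.1.le (fun x hx => hψd x (hsub hx))
        (fun x hx => hφd x (hsub hx)) (fun x hx => hφ0 x (hsub hx)) fun x hx => ?_
      have hx1 := hsub (Ioo_subset_Icc_self hx)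
      have := mul_nonneg (hδstay p hp x hx1 hx.1.le hp0) (hφ'pos x hx1).le
      linarith [hδφ' x hx1]
    rw [← intervalIntegral.integral_const_mul, ← intervalIntegral.integral_const_mul]
    have hp' := Ioo_subset_Icc_self hp
    exact integral_mono_on_of_le_Ioo hp.2.le ((hφi hp' h1mem).const_mul _)
      ((hψi hp' h1mem).const_mul _) hle
  · have hle : ∀ x ∈ Ioo (0:ℝ) 1, ∀ y ∈ Ioo (0:ℝ) 1, x ≤ y → y ≤ p → φ x * ψ y ≤ φ y * ψ x := by
      intro x hx y hy hxy hyp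
      have hsub := hIcc hx hy
      refine mul_le_mul_of_hasDerivAt_div hxy (fun z hz => hφd z (hsub hz))
        (fun z hz => hψd z (hsub hz)) (fun z hz => hψ0 z (hsub hz)) fun z hz => ?_
      have hz1 := hsub (Ioo_subset_Icc_self hz)
      have hz0 : δ z < 0 := by
        by_contra! hz0
        exact hp0.not_ge (hδstay z hz1 p hp (hz.2.le.trans hyp) hz0)
      have := mul_neg_of_neg_of_pos hz0 (hφ'pos z hz1)
      linarith [hδφ' z hz1]
    have hlim : ∀ y ∈ Ioo (0:ℝ) 1, y ≤ p → lX * ψ y ≤ lY * φ y := by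
      intro y hy hyp
      refine le_of_tendsto_of_tendsto (hlX.mul_const (ψ y)) (hlY.mul_const (φ y)) ?_
      filter_upwards [Ioo_mem_nhdsGT hy.1] with x hx
      rw [mul_comm (ψ x)]
      exact hle x ⟨hx.1, hx.2.trans hy.2⟩ y hy hx.2.le hyp
    have hp' := Ioo_subset_Icc_self hp
    have hI : lX * ∫ q in (0:ℝ)..p, ψ q ≤ lY * ∫ q in (0:ℝ)..p, φ q := by
      rw [← intervalIntegral.integral_const_mul, ← intervalIntegral.integral_const_mul]
      exact integral_mono_on_of_le_Ioo hp.1.le ((hψi h0mem hp').const_mul _)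
        ((hφi h0mem hp').const_mul _) fun q hq => hlim q ⟨hq.1, hq.2.trans hp.2⟩ hq.2.le
    have hI0 : 0 ≤ ∫ q in p..(1:ℝ), φ q := by
      have := integral_mono_on_of_le_Ioo hp.2.le (intervalIntegrable_const (c := (0:ℝ)))
        (hφi hp' h1mem) fun q hq => (hφ0 q ⟨hp.1.trans hq.1, hq.2⟩).le
      simpa using this
    have hXs := integral_add_adjacent_intervals (hφi h0mem hp') (hφi hp' h1mem)
    have hYs := integral_add_adjacent_intervals (hψi h0mem hp') (hψi hp' h1mem)
    rw [← hEX] at hXs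
    rw [← hEY] at hYs
    rw [← hXs, ← hYs] at hE
    have htail : lY * ∫ q in p..(1:ℝ), φ q ≤ lX * ∫ q in p..(1:ℝ), ψ q := by linarith
    refine le_of_mul_le_mul_left ?_ hlXpos
    linarith [mul_le_mul_of_nonneg_right (hlim p hp le_rfl) hI0,
      mul_le_mul_of_nonneg_left htail (hφ0 p hp).le]
end

section
/- Assume the unimodality hypothesis and suppose L₀ < 0, L₁ < 0, δ(p*) > 0, and l_X/E[X] − l_Y/E[Y] ≤ 0. Let p₁, p₂ with 0 < p₁ < p₂ < 1 be such that ψ/φ is nonincreasing on (0,p₁), nondecreasing on (p₁,p₂), and nonincreasing on (p₂,1) (such points exist by Theorem 2.1, Case 4(b)). Then X ≥_ps Y (i.e., EPS_X(p) ≥ EPS_Y(p) for all p ∈ (0,1)) if and only if EPS_X(p₁) ≥ EPS_Y(p₁). (Theorem on the expected proportional shortfall order, part 2(b).) -/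
open Set Filter Topology MeasureTheory intervalIntegral

/-- A function with positive derivative on `(0, 1)` and a nonnegative limit at `0⁺` is positive. -/
lemma pos_of_hasDerivAt_pos_of_tendsto {f f' : ℝ → ℝ} {l : ℝ}
    (hf : ∀ p ∈ Ioo (0:ℝ) 1, HasDerivAt f (f' p) p) (hf' : ∀ p ∈ Ioo (0:ℝ) 1, 0 < f' p)
    (hl : Tendsto f (𝓝[>] (0:ℝ)) (𝓝 l)) (hl0 : 0 ≤ l) {p : ℝ} (hp : p ∈ Ioo (0:ℝ) 1) :
    0 < f p := by
  have hmono : StrictMonoOn f (Ioo 0 1) := by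
    refine strictMonoOn_of_deriv_pos (convex_Ioo 0 1)
      (fun x hx => (hf x hx).continuousAt.continuousWithinAt) fun x hx => ?_
    rw [interior_Ioo] at hx
    rw [(hf x hx).deriv]
    exact hf' x hx
  have hhalf : p / 2 ∈ Ioo (0:ℝ) 1 := ⟨by linarith [hp.1], by linarith [hp.1, hp.2]⟩
  have hle : l ≤ f (p / 2) := by
    refine le_of_tendsto hl ?_
    filter_upwards [Ioo_mem_nhdsGT hhalf.1] with x hx
    exact (hmono ⟨hx.1, hx.2.trans hhalf.2⟩ hhalf hx.2).le
  exact (hl0.trans hle).trans_lt (hmono hhalf hp (by linarith [hp.1]))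

lemma MonotoneOn.Ioc_of_continuousAt {f : ℝ → ℝ} {a b : ℝ} (hab : a < b)
    (hf : MonotoneOn f (Ioo a b)) (hb : ContinuousAt f b) : MonotoneOn f (Ioc a b) := by
  rw [← Ioo_insert_right hab]
  refine hf.insert_of_continuousWithinAt ?_ hb.continuousWithinAt
  exact mem_closure_iff_clusterPt.1 (by rw [closure_Ioo hab.ne]; exact right_mem_Icc.2 hab.le)

lemma MonotoneOn.Icc_of_continuousAt {f : ℝ → ℝ} {a b : ℝ} (hab : a < b)
    (hf : MonotoneOn f (Ioo a b)) (ha : ContinuousAt f a) (hb : ContinuousAt f b) :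
    MonotoneOn f (Icc a b) := by
  rw [← Ioc_insert_left hab.le]
  refine (hf.Ioc_of_continuousAt hab hb).insert_of_continuousWithinAt ?_ ha.continuousWithinAt
  exact mem_closure_iff_clusterPt.1 (by rw [closure_Ioc hab.ne]; exact left_mem_Icc.2 hab.le)

lemma AntitoneOn.Ioc_of_continuousAt {f : ℝ → ℝ} {a b : ℝ} (hab : a < b)
    (hf : AntitoneOn f (Ioo a b)) (hb : ContinuousAt f b) : AntitoneOn f (Ioc a b) := by
  simpa using (hf.neg.Ioc_of_continuousAt hab hb.neg).neg

lemma AntitoneOn.Ico_of_continuousAt {f : ℝ → ℝ} {a b : ℝ} (hab : a < b)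
    (hf : AntitoneOn f (Ioo a b)) (ha : ContinuousAt f a) : AntitoneOn f (Ico a b) := by
  rw [← Ioo_insert_left hab]
  refine MonotoneOn.dual_right (β := ℝᵒᵈ) (MonotoneOn.insert_of_continuousWithinAt
    hf.dual_right ?_ ha.continuousWithinAt)
  exact mem_closure_iff_clusterPt.1 (by rw [closure_Ioo hab.ne]; exact left_mem_Icc.2 hab.le)

/-- The proportional shortfall comparison at `p` in terms of the upper tail integrals. -/
lemma shortfall_div_le_iff {φ ψ : ℝ → ℝ} {p : ℝ} (hφ : 0 < φ p) (hψ : 0 < ψ p)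
    (hφint : IntervalIntegrable φ volume p 1) (hψint : IntervalIntegrable ψ volume p 1) :
    (∫ q in p..(1:ℝ), (ψ q - ψ p)) / ψ p ≤ (∫ q in p..(1:ℝ), (φ q - φ p)) / φ p ↔
      ∫ q in p..(1:ℝ), ψ q ≤ ψ p / φ p * ∫ q in p..(1:ℝ), φ q := by
  rw [integral_sub hφint intervalIntegrable_const, integral_sub hψint intervalIntegrable_const,
    intervalIntegral.integral_const, intervalIntegral.integral_const, smul_eq_mul, smul_eq_mul,
    sub_div, sub_div, mul_div_cancel_right₀ _ hφ.ne', mul_div_cancel_right₀ _ hψ.ne',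
    sub_le_sub_iff_right, div_le_iff₀ hψ]
  rw [show ψ p / φ p * ∫ q in p..(1:ℝ), φ q = (∫ q in p..(1:ℝ), φ q) / φ p * ψ p by ring]

theorem stmt13
    (φ ψ φ' ψ' r δ : ℝ → ℝ)
    (hφd : ∀ p ∈ Ioo (0:ℝ) 1, HasDerivAt φ (φ' p) p)
    (hψd : ∀ p ∈ Ioo (0:ℝ) 1, HasDerivAt ψ (ψ' p) p)
    (hφ'pos : ∀ p ∈ Ioo (0:ℝ) 1, 0 < φ' p)
    (hψ'pos : ∀ p ∈ Ioo (0:ℝ) 1, 0 < ψ' p)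
    (hr : ∀ p ∈ Ioo (0:ℝ) 1, r p = ψ' p / φ' p)
    (hrc : ContinuousOn r (Ioo 0 1))
    (lX lY : ℝ)
    (hlX : Tendsto φ (𝓝[>] (0:ℝ)) (𝓝 lX))
    (hlY : Tendsto ψ (𝓝[>] (0:ℝ)) (𝓝 lY))
    (hlX0 : 0 ≤ lX) (hlY0 : 0 ≤ lY)
    (hδ : ∀ p ∈ Ioo (0:ℝ) 1, δ p = φ p * r p - ψ p)
    (pstar : ℝ) (hpstar : pstar ∈ Ioo (0:ℝ) 1)
    (hrup : MonotoneOn r (Ioo 0 pstar))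
    (hrdown : AntitoneOn r (Ioo pstar 1))
    (L₀ L₁ : EReal)
    (hL₀ : Tendsto (fun q => (δ q : EReal)) (𝓝[>] (0:ℝ)) (𝓝 L₀))
    (hL₁ : Tendsto (fun q => (δ q : EReal)) (𝓝[<] (1:ℝ)) (𝓝 L₁))
    (hφint : IntervalIntegrable φ volume 0 1)
    (hψint : IntervalIntegrable ψ volume 0 1)
    (EX EY : ℝ)
    (hEX : EX = ∫ q in (0:ℝ)..1, φ q) (hEY : EY = ∫ q in (0:ℝ)..1, ψ q)
    (hEXpos : 0 < EX) (hEYpos : 0 < EY)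
    (EPSX EPSY : ℝ → ℝ)
    (hEPSX : ∀ p ∈ Ioo (0:ℝ) 1, EPSX p = (∫ q in p..(1:ℝ), (φ q - φ p)) / φ p)
    (hEPSY : ∀ p ∈ Ioo (0:ℝ) 1, EPSY p = (∫ q in p..(1:ℝ), (ψ q - ψ p)) / ψ p)
    (h0 : L₀ < 0) (h1 : L₁ < 0) (hstar : 0 < δ pstar)
    (hmeans : lX / EX - lY / EY ≤ 0)
    (p₁ p₂ : ℝ) (hp₁ : 0 < p₁) (hp₁₂ : p₁ < p₂) (hp₂ : p₂ < 1)
    (hrat1 : AntitoneOn (fun t => ψ t / φ t) (Ioo 0 p₁))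
    (hrat2 : MonotoneOn (fun t => ψ t / φ t) (Ioo p₁ p₂))
    (hrat3 : AntitoneOn (fun t => ψ t / φ t) (Ioo p₂ 1)) :
    (∀ p ∈ Ioo (0:ℝ) 1, EPSY p ≤ EPSX p) ↔ EPSY p₁ ≤ EPSX p₁ := by
  have hφpos : ∀ p ∈ Ioo (0:ℝ) 1, 0 < φ p := fun p hp =>
    pos_of_hasDerivAt_pos_of_tendsto hφd hφ'pos hlX hlX0 hp
  have hψpos : ∀ p ∈ Ioo (0:ℝ) 1, 0 < ψ p := fun p hp =>
    pos_of_hasDerivAt_pos_of_tendsto hψd hψ'pos hlY hlY0 hp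
  have hint : ∀ {f : ℝ → ℝ}, IntervalIntegrable f volume 0 1 → ∀ {a b : ℝ}, 0 ≤ a → a ≤ b →
      b ≤ 1 → IntervalIntegrable f volume a b := fun hf a b ha hab hb => hf.mono_set (by
    rw [uIcc_of_le hab, uIcc_of_le zero_le_one]
    exact Icc_subset_Icc ha hb)
  set ρ : ℝ → ℝ := fun t => ψ t / φ t
  have hcont : ∀ p ∈ Ioo (0:ℝ) 1, ContinuousAt ρ p := fun p hp =>
    (hψd p hp).continuousAt.div (hφd p hp).continuousAt (hφpos p hp).ne'
  have hψeq : ∀ p ∈ Ioo (0:ℝ) 1, ψ p = ρ p * φ p := fun p hp =>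
    (div_mul_cancel₀ _ (hφpos p hp).ne').symm
  have hp₁m : p₁ ∈ Ioo (0:ℝ) 1 := ⟨hp₁, hp₁₂.trans hp₂⟩
  have hp₂m : p₂ ∈ Ioo (0:ℝ) 1 := ⟨hp₁.trans hp₁₂, hp₂⟩
  have hanti1 := hrat1.Ioc_of_continuousAt hp₁ (hcont p₁ hp₁m)
  have hmono2 := hrat2.Icc_of_continuousAt hp₁₂ (hcont p₁ hp₁m) (hcont p₂ hp₂m)
  have hanti3 := hrat3.Ico_of_continuousAt hp₂ (hcont p₂ hp₂m)
  have hiff : ∀ p ∈ Ioo (0:ℝ) 1, EPSY p ≤ EPSX p ↔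
      ∫ q in p..(1:ℝ), ψ q ≤ ρ p * ∫ q in p..(1:ℝ), φ q := fun p hp => by
    rw [hEPSX p hp, hEPSY p hp]
    exact shortfall_div_le_iff (hφpos p hp) (hψpos p hp) (hint hφint hp.1.le hp.2.le le_rfl)
      (hint hψint hp.1.le hp.2.le le_rfl)
  have hupper : ∀ {a b c : ℝ}, 0 ≤ a → a ≤ b → b ≤ 1 → (∀ q ∈ Ioo a b, ρ q ≤ c) →
      ∫ q in a..b, ψ q ≤ c * ∫ q in a..b, φ q := by
    intro a b c ha hab hb h
    rw [← intervalIntegral.integral_const_mul]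
    refine integral_mono_on_of_le_Ioo hab (hint hψint ha hab hb)
      ((hint hφint ha hab hb).const_mul c) fun q hq => ?_
    have hq' : q ∈ Ioo (0:ℝ) 1 := ⟨ha.trans_lt hq.1, hq.2.trans_le hb⟩
    rw [hψeq q hq']
    exact mul_le_mul_of_nonneg_right (h q hq) (hφpos q hq').le
  have hlower : ∀ {a b c : ℝ}, 0 ≤ a → a ≤ b → b ≤ 1 → (∀ q ∈ Ioo a b, c ≤ ρ q) →
      c * ∫ q in a..b, φ q ≤ ∫ q in a..b, ψ q := by
    intro a b c ha hab hb h
    rw [← intervalIntegral.integral_const_mul]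
    refine integral_mono_on_of_le_Ioo hab ((hint hφint ha hab hb).const_mul c)
      (hint hψint ha hab hb) fun q hq => ?_
    have hq' : q ∈ Ioo (0:ℝ) 1 := ⟨ha.trans_lt hq.1, hq.2.trans_le hb⟩
    rw [hψeq q hq']
    exact mul_le_mul_of_nonneg_right (h q hq) (hφpos q hq').le
  have htail : ∀ p ∈ Ioo (0:ℝ) 1, 0 ≤ ∫ q in p..(1:ℝ), φ q := fun p hp => by
    have h := integral_mono_on_of_le_Ioo hp.2.le intervalIntegrable_const
      (hint hφint hp.1.le hp.2.le le_rfl)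
      fun q hq => (hφpos q ⟨hp.1.trans hq.1, hq.2⟩).le
    simpa using h
  have hsplit : ∀ {f : ℝ → ℝ}, IntervalIntegrable f volume 0 1 → ∀ {a b : ℝ}, 0 ≤ a → a ≤ b →
      b ≤ 1 → (∫ q in a..b, f q) + ∫ q in b..(1:ℝ), f q = ∫ q in a..(1:ℝ), f q :=
    fun hf a b ha hab hb => integral_add_adjacent_intervals (hint hf ha hab hb)
      (hint hf (ha.trans hab) hb le_rfl)
  refine ⟨fun h => h p₁ hp₁m, fun h p hp => ?_⟩
  rw [hiff p₁ hp₁m] at h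
  rw [hiff p hp]
  rcases le_total p p₁ with hpp₁ | hpp₁
  · have hle : ρ p₁ ≤ ρ p := hanti1 ⟨hp.1, hpp₁⟩ ⟨hp₁, le_rfl⟩ hpp₁
    have hI := hupper hp.1.le hpp₁ hp₁m.2.le fun q hq =>
      hanti1 ⟨hp.1, hpp₁⟩ ⟨hp.1.trans hq.1, hq.2.le⟩ hq.1.le
    have hJ := mul_le_mul_of_nonneg_right hle (htail p₁ hp₁m)
    rw [← hsplit hφint hp.1.le hpp₁ hp₁m.2.le, ← hsplit hψint hp.1.le hpp₁ hp₁m.2.le, mul_add]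
    linarith
  rcases le_total p p₂ with hpp₂ | hpp₂
  · have hle : ρ p₁ ≤ ρ p := hmono2 ⟨le_rfl, hp₁₂.le⟩ ⟨hpp₁, hpp₂⟩ hpp₁
    have hI := hlower hp₁.le hpp₁ hp.2.le fun q hq =>
      hmono2 ⟨le_rfl, hp₁₂.le⟩ ⟨hq.1.le, hq.2.le.trans hpp₂⟩ hq.1.le
    have hJ := mul_le_mul_of_nonneg_right hle (htail p hp)
    rw [← hsplit hφint hp₁.le hpp₁ hp.2.le, ← hsplit hψint hp₁.le hpp₁ hp.2.le, mul_add] at h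
    linarith
  · exact hupper hp.1.le hp.2.le le_rfl fun q hq =>
      hanti3 ⟨hpp₂, hp.2⟩ ⟨hpp₂.trans hq.1.le, hq.2⟩ hq.1.le
end

section
/- Let m ≥ 1 and 0 < p₁ < ⋯ < p_{2m} < 1; set p₀ := 0 and p_{2m+1} := 1, and assume r is nondecreasing on (p_{k−1}, p_k) for every odd k and nonincreasing on (p_{k−1}, p_k) for every even k, for 1 ≤ k ≤ 2m+1 (so the quantile density ratio has an even number n = 2m of modes, the first one occurring from increasing to decreasing). Then X ≤_qmit Y — i.e., the function p ↦ (∫₀^p q·ψ'(q) dq)/(∫₀^p q·φ'(q) dq) is monotone nondecreasing on (0,1) — if and only if, for every i = 1,…,m, ∫₀^{p_{2i}} q·( r(p_{2i})·φ'(q) − ψ'(q) ) dq ≥ 0. -/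
open Set Filter Topology MeasureTheory intervalIntegral

/-- A continuous function on a closed interval that is monotone in the interior is monotone. -/
theorem monotoneOn_Icc_of_monotoneOn_Ioo {f : ℝ → ℝ} {a b : ℝ}
    (hc : ContinuousOn f (Icc a b)) (hm : MonotoneOn f (Ioo a b)) :
    MonotoneOn f (Icc a b) := by
  rcases lt_or_ge a b with hab | hab
  · intro x hx y hy hxy
    rcases hxy.eq_or_lt with rfl | hxy
    · exact le_rfl
    obtain ⟨z, hxz, hzy⟩ := exists_between hxy
    have hz : z ∈ Ioo a b := ⟨hx.1.trans_lt hxz, hzy.trans_le hy.2⟩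
    have h1 : f x ≤ f z := by
      refine ContinuousWithinAt.closure_le (s := Ioo x z) ?_ ?_ continuousWithinAt_const ?_
      · rw [closure_Ioo hxz.ne]; exact left_mem_Icc.2 hxz.le
      · exact (hc x hx).mono fun w hw => ⟨hx.1.trans hw.1.le, hw.2.le.trans hz.2.le⟩
      · exact fun w hw => hm ⟨hx.1.trans_lt hw.1, hw.2.trans hz.2⟩ hz hw.2.le
    have h2 : f z ≤ f y := by
      refine ContinuousWithinAt.closure_le (s := Ioo z y) ?_ continuousWithinAt_const ?_ ?_
      · rw [closure_Ioo hzy.ne]; exact right_mem_Icc.2 hzy.le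
      · exact (hc y hy).mono fun w hw => ⟨hz.1.le.trans hw.1.le, hw.2.le.trans hy.2⟩
      · exact fun w hw => hm hz ⟨hz.1.trans hw.1, hw.2.trans_le hy.2⟩ hw.1.le
    exact h1.trans h2
  · intro x hx y hy hxy
    rw [le_antisymm hxy (by linarith [hx.1, hy.2])]

/-- A continuous function on a closed interval that is antitone in the interior is antitone. -/
theorem antitoneOn_Icc_of_antitoneOn_Ioo {f : ℝ → ℝ} {a b : ℝ}
    (hc : ContinuousOn f (Icc a b)) (hm : AntitoneOn f (Ioo a b)) :
    AntitoneOn f (Icc a b) := by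
  have h := monotoneOn_Icc_of_monotoneOn_Ioo (f := fun x => -f x) hc.neg hm.neg
  exact fun x hx y hy hxy => neg_le_neg_iff.1 (h hx hy hxy)

/-- If the increments of `B` are controlled by those of `A` through the density `r`, then `B / A`
is monotone exactly when it is dominated by `r`. -/
theorem monotoneOn_div_iff_le_mul {A B r : ℝ → ℝ}
    (hA0 : A 0 = 0) (hA : StrictMonoOn A (Ico 0 1))
    (hAc : ContinuousOn A (Ico 0 1)) (hBc : ContinuousOn B (Ico 0 1))
    (hrc : ContinuousOn r (Ioo 0 1))
    (hlow : ∀ s t c, 0 ≤ s → s ≤ t → t < 1 → (∀ q ∈ Ioo s t, c ≤ r q) →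
      c * (A t - A s) ≤ B t - B s)
    (hup : ∀ s t c, 0 ≤ s → s ≤ t → t < 1 → (∀ q ∈ Ioo s t, r q ≤ c) →
      B t - B s ≤ c * (A t - A s)) :
    MonotoneOn (fun t => B t / A t) (Ioo 0 1) ↔ ∀ t ∈ Ioo (0:ℝ) 1, B t ≤ r t * A t := by
  have hpos : ∀ t ∈ Ioo (0:ℝ) 1, 0 < A t := fun t ht =>
    hA0 ▸ hA ⟨le_rfl, one_pos⟩ ⟨ht.1.le, ht.2⟩ ht.1
  constructor
  · intro hmono t ht
    by_contra! hlt
    obtain ⟨c, hc1, hc2⟩ := exists_between ((lt_div_iff₀ (hpos t ht)).2 hlt)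
    have hev : ∀ᶠ q in 𝓝 t, r q < c ∧ q < 1 :=
      ((hrc.continuousAt (Ioo_mem_nhds ht.1 ht.2)).eventually_lt_const hc1).and
        (eventually_lt_nhds ht.2)
    obtain ⟨ε, hε, hball⟩ := Metric.eventually_nhds_iff.1 hev
    have hmem : ∀ q, t ≤ q → q ≤ t + ε / 2 → r q < c ∧ q < 1 := fun q h1 h2 =>
      hball (by rw [Real.dist_eq, abs_lt]; constructor <;> linarith)
    obtain ⟨u, hu⟩ : ∃ u, u = t + ε / 2 := ⟨_, rfl⟩
    have htu : t < u := by linarith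
    have hu1 : u ∈ Ioo (0:ℝ) 1 := ⟨ht.1.trans htu, (hmem u htu.le hu.le).2⟩
    have h1 := hup t u c ht.1.le htu.le hu1.2 fun q hq =>
      (hmem q hq.1.le (hu ▸ hq.2.le)).1.le
    have h2 : B t / A t ≤ B u / A u := hmono ht hu1 htu.le
    have h3 : A t < A u := hA ⟨ht.1.le, ht.2⟩ ⟨hu1.1.le, hu1.2⟩ htu
    rw [le_div_iff₀ (hpos u hu1)] at h2
    have h4 : B t / A t * A t = B t := div_mul_cancel₀ _ (hpos t ht).ne'
    nlinarith [mul_lt_mul_of_pos_right hc2 (sub_pos.2 h3)]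
  · intro hle s hs t ht hst
    have hsub : Icc s t ⊆ Ioo 0 1 := fun q hq => ⟨hs.1.trans_le hq.1, hq.2.trans_lt ht.2⟩
    have hcont : ContinuousOn (fun t => B t / A t) (Icc s t) :=
      (hBc.mono (hsub.trans Ioo_subset_Ico_self)).div
        (hAc.mono (hsub.trans Ioo_subset_Ico_self)) fun q hq => (hpos q (hsub hq)).ne'
    obtain ⟨x, hx, hmin⟩ := isCompact_Icc.exists_isMinOn (nonempty_Icc.2 hst) hcont
    have hx1 := hsub hx
    have h1 := hlow s x (B x / A x) hs.1.le hx.1 hx1.2 fun q hq => by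
      have hq' : q ∈ Icc s t := ⟨hq.1.le, hq.2.le.trans hx.2⟩
      exact (hmin hq').trans
        ((div_le_iff₀ (hpos q (hsub hq'))).2 (hle q (hsub hq')))
    have h2 : B x / A x * A x = B x := div_mul_cancel₀ _ (hpos x hx1).ne'
    have h3 : B s / A s ≤ B x / A x := (div_le_iff₀ (hpos s hs)).2 (by linarith)
    exact h3.trans (hmin (right_mem_Icc.2 hst))

/-- If `r` alternates between increasing and decreasing, starting with increasing, along
`p 0 < ⋯ < p (2 * m + 1)`, then the domination of `B` by `r * A` need only be tested at the
minima of `r`. -/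
theorem forall_le_mul_iff_of_alternating {A B r : ℝ → ℝ}
    (hA0 : A 0 = 0) (hB0 : B 0 = 0) (hA : StrictMonoOn A (Ico 0 1))
    (hrc : ContinuousOn r (Ioo 0 1))
    (hlow : ∀ s t c, 0 ≤ s → s ≤ t → t < 1 → (∀ q ∈ Ioo s t, c ≤ r q) →
      c * (A t - A s) ≤ B t - B s)
    (hup : ∀ s t c, 0 ≤ s → s ≤ t → t < 1 → (∀ q ∈ Ioo s t, r q ≤ c) →
      B t - B s ≤ c * (A t - A s))
    {m : ℕ} {p : ℕ → ℝ} (hp0 : p 0 = 0) (hplast : p (2*m+1) = 1)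
    (hpmono : ∀ k ≤ 2*m, p k < p (k+1))
    (hodd : ∀ k, 1 ≤ k → k ≤ 2*m+1 → Odd k → MonotoneOn r (Ioo (p (k-1)) (p k)))
    (heven : ∀ k, 1 ≤ k → k ≤ 2*m+1 → Even k → AntitoneOn r (Ioo (p (k-1)) (p k))) :
    (∀ t ∈ Ioo (0:ℝ) 1, B t ≤ r t * A t) ↔
      ∀ i, 1 ≤ i → i ≤ m → B (p (2*i)) ≤ r (p (2*i)) * A (p (2*i)) := by
  have hlt : ∀ j k, j < k → k ≤ 2*m+1 → p j < p k := by
    intro j k hjk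
    induction k, hjk using Nat.le_induction with
    | base => exact fun h => hpmono j (by lia)
    | succ k hk ih => exact fun h => (ih (by lia)).trans (hpmono k (by lia))
  have hmem : ∀ k, 1 ≤ k → k ≤ 2*m → p k ∈ Ioo (0:ℝ) 1 := fun k h1 h2 =>
    ⟨hp0 ▸ hlt 0 k (by lia) (by lia), hplast ▸ hlt k (2*m+1) (by lia) le_rfl⟩
  have hnonneg : ∀ t, 0 ≤ t → t < 1 → 0 ≤ A t := fun t h0 h1 =>
    hA0 ▸ hA.monotoneOn ⟨le_rfl, one_pos⟩ ⟨h0, h1⟩ h0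
  have hloc : ∀ t, 0 ≤ t → ∀ n, t < p n → ∃ k < n, p k ≤ t ∧ t < p (k+1) := by
    intro t ht n
    induction n with
    | zero => intro h; linarith
    | succ n ih =>
      intro h
      rcases lt_or_ge t (p n) with h' | h'
      · obtain ⟨k, hk, h⟩ := ih h'
        exact ⟨k, by lia, h⟩
      · exact ⟨n, by lia, h', h⟩
  refine ⟨fun h i h1 h2 => h _ (hmem _ (by lia) (by lia)), fun h t ht => ?_⟩
  obtain ⟨k, hk, hkt, htk⟩ := hloc t ht.1.le (2*m+1) (hplast ▸ ht.2)
  rcases Nat.even_or_odd' k with ⟨i, rfl | rfl⟩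
  · have hmon := hodd (2*i+1) (by lia) (by lia) ⟨i, rfl⟩
    rw [Nat.add_sub_cancel] at hmon
    rcases Nat.eq_zero_or_pos i with rfl | hi
    · have hup' := hup 0 t (r t) le_rfl ht.1.le ht.2 fun q hq =>
        hmon ⟨by rw [mul_zero, hp0]; exact hq.1, hq.2.trans htk⟩
          ⟨by rw [mul_zero, hp0]; exact ht.1, htk⟩ hq.2.le
      rw [hA0, hB0] at hup'
      linarith
    · have hi0 := hmem (2*i) (by lia) (by lia)
      have hmon' : MonotoneOn r (Icc (p (2*i)) t) :=
        monotoneOn_Icc_of_monotoneOn_Ioo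
          (hrc.mono fun q hq => ⟨hi0.1.trans_le hq.1, hq.2.trans_lt ht.2⟩)
          (hmon.mono (Ioo_subset_Ioo_right htk.le))
      have h1 := h i hi (by lia)
      have h2 := hup (p (2*i)) t (r t) hi0.1.le hkt ht.2 fun q hq =>
        hmon' ⟨hq.1.le, hq.2.le⟩ (right_mem_Icc.2 hkt) hq.2.le
      have h3 := mul_le_mul_of_nonneg_right
        (hmon' (left_mem_Icc.2 hkt) (right_mem_Icc.2 hkt) hkt) (hnonneg _ hi0.1.le hi0.2)
      linarith
  · have hanti := heven (2*i+1+1) (by lia) (by lia) ⟨i+1, by lia⟩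
    rw [Nat.add_sub_cancel] at hanti
    have hi0 := hmem (2*i+1) (by lia) (by lia)
    have hi1 := hmem (2*i+1+1) (by lia) (by lia)
    have hanti' := antitoneOn_Icc_of_antitoneOn_Ioo
      (hrc.mono fun q hq => ⟨hi0.1.trans_le hq.1, hq.2.trans_lt hi1.2⟩) hanti
    have h1 : B (p (2*i+1+1)) ≤ r (p (2*i+1+1)) * A (p (2*i+1+1)) :=
      h (i+1) (by lia) (by lia)
    have hr' := right_mem_Icc.2 (hkt.trans htk.le)
    have h2 := hlow t (p (2*i+1+1)) (r (p (2*i+1+1))) ht.1.le htk.le hi1.2 fun q hq =>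
      hanti' ⟨hkt.trans hq.1.le, hq.2.le⟩ hr' hq.2.le
    have h3 := mul_le_mul_of_nonneg_right
      (hanti' ⟨hkt, htk.le⟩ hr' htk.le) (hnonneg _ ht.1.le ht.2)
    linarith

theorem stmt14
    (φ ψ φ' ψ' r : ℝ → ℝ)
    (hφd : ∀ p ∈ Ioo (0:ℝ) 1, HasDerivAt φ (φ' p) p)
    (hψd : ∀ p ∈ Ioo (0:ℝ) 1, HasDerivAt ψ (ψ' p) p)
    (hφ'pos : ∀ p ∈ Ioo (0:ℝ) 1, 0 < φ' p)
    (hψ'pos : ∀ p ∈ Ioo (0:ℝ) 1, 0 < ψ' p)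
    (hr : ∀ p ∈ Ioo (0:ℝ) 1, r p = ψ' p / φ' p)
    (hrc : ContinuousOn r (Ioo 0 1))
    (hφ'int : IntervalIntegrable (fun q => q * φ' q) volume 0 1)
    (hψ'int : IntervalIntegrable (fun q => q * ψ' q) volume 0 1)
    (m : ℕ) (hm : 1 ≤ m) (p : ℕ → ℝ)
    (hp0 : p 0 = 0) (hplast : p (2*m+1) = 1)
    (hpmono : ∀ k ≤ 2*m, p k < p (k+1))
    (hodd : ∀ k, 1 ≤ k → k ≤ 2*m+1 → Odd k → MonotoneOn r (Ioo (p (k-1)) (p k)))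
    (heven : ∀ k, 1 ≤ k → k ≤ 2*m+1 → Even k → AntitoneOn r (Ioo (p (k-1)) (p k))) :
    MonotoneOn (fun t => (∫ q in (0:ℝ)..t, q * ψ' q) / (∫ q in (0:ℝ)..t, q * φ' q)) (Ioo 0 1) ↔
      (∀ i, 1 ≤ i → i ≤ m →
        0 ≤ ∫ q in (0:ℝ)..(p (2*i)), q * (r (p (2*i)) * φ' q - ψ' q)) := by
  have hsub : ∀ {f : ℝ → ℝ}, IntervalIntegrable f volume 0 1 → ∀ s t, 0 ≤ s → s ≤ t → t ≤ 1 →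
      IntervalIntegrable f volume s t := fun hf s t h0 hst h1 =>
    hf.mono_set (by
      rw [uIcc_of_le hst, uIcc_of_le zero_le_one]
      exact Icc_subset_Icc h0 h1)
  have hinc : ∀ {f : ℝ → ℝ}, IntervalIntegrable f volume 0 1 → ∀ s t, 0 ≤ s → s ≤ t → t ≤ 1 →
      (∫ q in (0:ℝ)..t, f q) - ∫ q in (0:ℝ)..s, f q = ∫ q in s..t, f q :=
    fun hf s t h0 hst h1 => integral_interval_sub_left
      (hsub hf 0 t le_rfl (h0.trans hst) h1) (hsub hf 0 s le_rfl h0 (hst.trans h1))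
  have hcont : ∀ {f : ℝ → ℝ}, IntervalIntegrable f volume 0 1 →
      ContinuousOn (fun t => ∫ q in (0:ℝ)..t, f q) (Ico 0 1) := fun hf =>
    (continuousOn_primitive_interval' hf left_mem_uIcc).mono (by
      rw [uIcc_of_le zero_le_one]; exact Ico_subset_Icc_self)
  have hψr : ∀ q ∈ Ioo (0:ℝ) 1, q * ψ' q = r q * (q * φ' q) := fun q hq => by
    have := (hφ'pos q hq).ne'
    rw [hr q hq]
    field_simp
  have hA : StrictMonoOn (fun t => ∫ q in (0:ℝ)..t, q * φ' q) (Ico 0 1) := by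
    intro s hs t ht hst
    refine sub_pos.1 ?_
    rw [hinc hφ'int s t hs.1 hst.le ht.2.le]
    exact intervalIntegral_pos_of_pos_on (hsub hφ'int s t hs.1 hst.le ht.2.le)
      (fun q hq => mul_pos (hs.1.trans_lt hq.1)
        (hφ'pos q ⟨hs.1.trans_lt hq.1, hq.2.trans ht.2⟩)) hst
  have hlow : ∀ s t c, 0 ≤ s → s ≤ t → t < 1 → (∀ q ∈ Ioo s t, c ≤ r q) →
      c * ((∫ q in (0:ℝ)..t, q * φ' q) - ∫ q in (0:ℝ)..s, q * φ' q) ≤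
        (∫ q in (0:ℝ)..t, q * ψ' q) - ∫ q in (0:ℝ)..s, q * ψ' q := by
    intro s t c h0 hst h1 hc
    rw [hinc hφ'int s t h0 hst h1.le, hinc hψ'int s t h0 hst h1.le,
      ← intervalIntegral.integral_const_mul]
    refine integral_mono_on_of_le_Ioo hst ((hsub hφ'int s t h0 hst h1.le).const_mul c)
      (hsub hψ'int s t h0 hst h1.le) fun q hq => ?_
    have hq' : q ∈ Ioo (0:ℝ) 1 := ⟨h0.trans_lt hq.1, hq.2.trans h1⟩
    rw [hψr q hq']
    exact mul_le_mul_of_nonneg_right (hc q hq) (mul_pos hq'.1 (hφ'pos q hq')).le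
  have hup : ∀ s t c, 0 ≤ s → s ≤ t → t < 1 → (∀ q ∈ Ioo s t, r q ≤ c) →
      (∫ q in (0:ℝ)..t, q * ψ' q) - ∫ q in (0:ℝ)..s, q * ψ' q ≤
        c * ((∫ q in (0:ℝ)..t, q * φ' q) - ∫ q in (0:ℝ)..s, q * φ' q) := by
    intro s t c h0 hst h1 hc
    rw [hinc hφ'int s t h0 hst h1.le, hinc hψ'int s t h0 hst h1.le,
      ← intervalIntegral.integral_const_mul]
    refine integral_mono_on_of_le_Ioo hst (hsub hψ'int s t h0 hst h1.le)
      ((hsub hφ'int s t h0 hst h1.le).const_mul c) fun q hq => ?_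
    have hq' : q ∈ Ioo (0:ℝ) 1 := ⟨h0.trans_lt hq.1, hq.2.trans h1⟩
    rw [hψr q hq']
    exact mul_le_mul_of_nonneg_right (hc q hq) (mul_pos hq'.1 (hφ'pos q hq')).le
  have hsplit : ∀ t c, 0 ≤ t → t ≤ 1 → ∫ q in (0:ℝ)..t, q * (c * φ' q - ψ' q) =
      c * (∫ q in (0:ℝ)..t, q * φ' q) - ∫ q in (0:ℝ)..t, q * ψ' q := by
    intro t c h0 h1
    rw [← intervalIntegral.integral_const_mul, ← intervalIntegral.integral_sub
      ((hsub hφ'int 0 t le_rfl h0 h1).const_mul c) (hsub hψ'int 0 t le_rfl h0 h1)]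
    congr 1
    ext q
    ring
  have hp : ∀ k ≤ 2*m+1, 0 ≤ p k ∧ p k ≤ 1 := by
    have hmono : MonotoneOn p (Iic (2*m+1)) :=
      monotoneOn_of_le_succ ordConnected_Iic fun k _ _ hk =>
        (hpmono k (by simpa using hk)).le
    exact fun k hk => ⟨hp0 ▸ hmono (by simp) hk (Nat.zero_le k), hplast ▸ hmono hk (by simp) hk⟩
  rw [monotoneOn_div_iff_le_mul integral_same hA (hcont hφ'int) (hcont hψ'int) hrc hlow hup,
    forall_le_mul_iff_of_alternating integral_same integral_same hA hrc hlow hup hp0 hplast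
      hpmono hodd heven]
  refine forall_congr' fun i => forall_congr' fun _ => forall_congr' fun hi => ?_
  obtain ⟨h0, h1⟩ := hp (2*i) (by lia)
  rw [hsplit _ _ h0 h1, sub_nonneg]
end

section
/- Assume there exists p* ∈ (0,1) such that r is nondecreasing on (0,p*) and nonincreasing on (p*,1). Then X ≤_qmit Y — i.e., the function p ↦ (∫₀^p q·ψ'(q) dq)/(∫₀^p q·φ'(q) dq) is monotone nondecreasing on (0,1) — if and only if lim_{p→1⁻} [ r(p)·(φ(p) − E[X]) − (ψ(p) − E[Y]) ] ≥ 0, where the limit exists in the extended reals [−∞,+∞]. (Corollary for the qmit order when the quantile density ratio has exactly one mode.) -/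
open Set Filter Topology MeasureTheory intervalIntegral

/-- If `φ` is integrable near `0` and `t * φ t` converges as `t → 0⁺`, then the limit is `0`. -/
lemma eq_zero_of_tendsto_mul_of_intervalIntegrable {φ : ℝ → ℝ} {c : ℝ}
    (hφ : IntervalIntegrable φ volume 0 1)
    (hc : Tendsto (fun t => t * φ t) (𝓝[>] (0:ℝ)) (𝓝 c)) : c = 0 := by
  by_contra hne
  have hpos : 0 < |c| := abs_pos.mpr hne
  have hev : ∀ᶠ t in 𝓝[>] (0:ℝ), |c| / 2 < |t * φ t| :=
    hc.abs.eventually (lt_mem_nhds (by linarith))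
  obtain ⟨d, hd, hsub⟩ := (mem_nhdsGT_iff_exists_Ioc_subset).1 hev
  have hd0 : (0:ℝ) < d := hd
  have hm : 0 < min d 1 := lt_min hd0 one_pos
  have hφm : IntervalIntegrable φ volume 0 (min d 1) := by
    refine hφ.mono_set ?_
    rw [uIcc_of_le hm.le, uIcc_of_le zero_le_one]
    exact Icc_subset_Icc_right (min_le_right _ _)
  have hinv : IntervalIntegrable (fun t : ℝ => t⁻¹) volume 0 (min d 1) := by
    refine (hφm.norm.const_mul (2 / |c|)).mono_fun
      (measurable_inv.aestronglyMeasurable) ?_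
    rw [uIoc_of_le hm.le]
    refine (ae_restrict_iff' measurableSet_Ioc).2 (Eventually.of_forall fun t ht => ?_)
    have h1 : |c| / 2 < |t * φ t| := hsub ⟨ht.1, ht.2.trans (min_le_left _ _)⟩
    have ht0 : 0 < t := ht.1
    rw [abs_mul, abs_of_pos ht0] at h1
    simp only [norm_inv, norm_mul, Real.norm_eq_abs, abs_of_pos ht0, norm_div, abs_abs]
    rw [abs_two, inv_le_iff_one_le_mul₀ ht0, div_mul_eq_mul_div, div_mul_eq_mul_div,
      le_div_iff₀ hpos]
    linarith
  rw [intervalIntegrable_inv_iff] at hinv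
  rcases hinv with h | h
  · exact hm.ne h
  · exact h left_mem_uIcc

lemma intervalIntegrable_sub_of_mem_Icc {f : ℝ → ℝ} (hf : IntervalIntegrable f volume 0 1)
    {s t : ℝ} (hs : s ∈ Icc (0:ℝ) 1) (ht : t ∈ Icc (0:ℝ) 1) :
    IntervalIntegrable f volume s t :=
  hf.mono_set (by rw [uIcc_of_le zero_le_one]; exact uIcc_subset_Icc hs ht)

lemma continuousOn_integral_Icc {f : ℝ → ℝ} (hf : IntervalIntegrable f volume 0 1) :
    ContinuousOn (fun t => ∫ q in (0:ℝ)..t, f q) (Icc 0 1) := by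
  have := continuousOn_primitive_interval' hf (left_mem_uIcc (a := (0:ℝ)) (b := 1))
  rwa [uIcc_of_le zero_le_one] at this

lemma tendsto_integral_nhdsGT_zero {f : ℝ → ℝ} (hf : IntervalIntegrable f volume 0 1) :
    Tendsto (fun t => ∫ q in (0:ℝ)..t, f q) (𝓝[>] (0:ℝ)) (𝓝 0) := by
  have h := continuousOn_integral_Icc hf 0 (left_mem_Icc.2 zero_le_one)
  simp only [ContinuousWithinAt, integral_same] at h
  rw [← nhdsWithin_Ioo_eq_nhdsGT (zero_lt_one (α := ℝ))]
  exact h.mono_left (nhdsWithin_mono _ Ioo_subset_Icc_self)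

lemma tendsto_integral_nhdsLT_one {f : ℝ → ℝ} (hf : IntervalIntegrable f volume 0 1) :
    Tendsto (fun t => ∫ q in (0:ℝ)..t, f q) (𝓝[<] (1:ℝ)) (𝓝 (∫ q in (0:ℝ)..1, f q)) := by
  have h := continuousOn_integral_Icc hf 1 (right_mem_Icc.2 zero_le_one)
  rw [← nhdsWithin_Ioo_eq_nhdsLT (zero_lt_one (α := ℝ))]
  exact h.mono_left (nhdsWithin_mono _ Ioo_subset_Icc_self)

lemma hasDerivAt_mul_sub_integral {φ φ' : ℝ → ℝ}
    (hφd : ∀ p ∈ Ioo (0:ℝ) 1, HasDerivAt φ (φ' p) p)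
    (hφ : IntervalIntegrable φ volume 0 1) {t : ℝ} (ht : t ∈ Ioo (0:ℝ) 1) :
    HasDerivAt (fun x => x * φ x - ∫ q in (0:ℝ)..x, φ q) (t * φ' t) t := by
  have hcont : ContinuousOn φ (Ioo 0 1) := fun x hx => (hφd x hx).continuousAt.continuousWithinAt
  have hI : HasDerivAt (fun x => ∫ q in (0:ℝ)..x, φ q) (φ t) t :=
    integral_hasDerivAt_right
      (intervalIntegrable_sub_of_mem_Icc hφ (left_mem_Icc.2 zero_le_one) (Ioo_subset_Icc_self ht))
      (hcont.stronglyMeasurableAtFilter isOpen_Ioo t ht) (hφd t ht).continuousAt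
  exact (((hasDerivAt_id t).mul (hφd t ht)).sub hI).congr_deriv (by simp only [id]; ring)

/-- Integration by parts for `∫ q φ'(q) dq`; the boundary term at `0` vanishes. -/
lemma integral_id_mul_deriv_eq {φ φ' : ℝ → ℝ}
    (hφd : ∀ p ∈ Ioo (0:ℝ) 1, HasDerivAt φ (φ' p) p)
    (hφ : IntervalIntegrable φ volume 0 1)
    (hφ' : IntervalIntegrable (fun q => q * φ' q) volume 0 1) {t : ℝ} (ht : t ∈ Ioo (0:ℝ) 1) :
    ∫ q in (0:ℝ)..t, q * φ' q = t * φ t - ∫ q in (0:ℝ)..t, φ q := by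
  have h0 : (0:ℝ) ∈ Icc (0:ℝ) 1 := left_mem_Icc.2 zero_le_one
  set G : ℝ → ℝ := fun x => x * φ x - ∫ q in (0:ℝ)..x, φ q with hG
  set A : ℝ → ℝ := fun x => ∫ q in (0:ℝ)..x, q * φ' q with hA
  have hparts : ∀ s ∈ Ioo (0:ℝ) 1, G s = A s + (G t - A t) := by
    intro s hs
    have hs' := Ioo_subset_Icc_self hs
    have ht' := Ioo_subset_Icc_self ht
    have h1 : ∫ q in s..t, q * φ' q = G t - G s :=
      integral_eq_sub_of_hasDerivAt
        (fun x hx => hasDerivAt_mul_sub_integral hφd hφ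
          ((ordConnected_Ioo.uIcc_subset hs ht) hx))
        (intervalIntegrable_sub_of_mem_Icc hφ' hs' ht')
    have h2 : A s + ∫ q in s..t, q * φ' q = A t :=
      integral_add_adjacent_intervals (intervalIntegrable_sub_of_mem_Icc hφ' h0 hs')
        (intervalIntegrable_sub_of_mem_Icc hφ' hs' ht')
    linarith
  have hlim : Tendsto (fun s => s * φ s) (𝓝[>] (0:ℝ)) (𝓝 (G t - A t)) := by
    have h := ((tendsto_integral_nhdsGT_zero hφ').add_const (G t - A t)).add
      (tendsto_integral_nhdsGT_zero hφ)
    rw [zero_add, add_zero] at h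
    refine h.congr' ?_
    filter_upwards [Ioo_mem_nhdsGT (zero_lt_one (α := ℝ))] with s hs
    have := hparts s hs
    simp only [hG, hA] at this ⊢
    linarith
  have hc := eq_zero_of_tendsto_mul_of_intervalIntegrable hφ hlim
  change A t = G t
  linarith

lemma hasDerivAt_integral_id_mul {φ φ' : ℝ → ℝ}
    (hφd : ∀ p ∈ Ioo (0:ℝ) 1, HasDerivAt φ (φ' p) p)
    (hφ : IntervalIntegrable φ volume 0 1)
    (hφ' : IntervalIntegrable (fun q => q * φ' q) volume 0 1) {t : ℝ} (ht : t ∈ Ioo (0:ℝ) 1) :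
    HasDerivAt (fun x => ∫ q in (0:ℝ)..x, q * φ' q) (t * φ' t) t := by
  refine (hasDerivAt_mul_sub_integral hφd hφ ht).congr_of_eventuallyEq ?_
  filter_upwards [isOpen_Ioo.mem_nhds ht] with s hs
  exact integral_id_mul_deriv_eq hφd hφ hφ' hs

lemma tendsto_integral_id_mul_sub {φ φ' : ℝ → ℝ}
    (hφd : ∀ p ∈ Ioo (0:ℝ) 1, HasDerivAt φ (φ' p) p)
    (hφ : IntervalIntegrable φ volume 0 1)
    (hφ' : IntervalIntegrable (fun q => q * φ' q) volume 0 1) :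
    Tendsto (fun t => (φ t - ∫ q in (0:ℝ)..1, φ q) - ∫ q in (0:ℝ)..t, q * φ' q)
      (𝓝[<] (1:ℝ)) (𝓝 0) := by
  have hA := tendsto_integral_nhdsLT_one hφ'
  have hI := tendsto_integral_nhdsLT_one hφ
  have hid : Tendsto (fun t : ℝ => t) (𝓝[<] (1:ℝ)) (𝓝 1) := nhdsWithin_le_nhds
  have hlim := (((hA.add hI).div hid one_ne_zero).sub_const (∫ q in (0:ℝ)..1, φ q)).sub hA
  rw [div_one, add_sub_cancel_right, sub_self] at hlim
  refine hlim.congr' ?_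
  filter_upwards [Ioo_mem_nhdsLT (zero_lt_one (α := ℝ))] with t ht
  have h := integral_id_mul_deriv_eq hφd hφ hφ' ht
  have : ((∫ q in (0:ℝ)..t, q * φ' q) + ∫ q in (0:ℝ)..t, φ q) / t = φ t := by
    rw [h, div_eq_iff ht.1.ne']
    ring
  simp only [Pi.div_apply, this]

/-- If `A' = a > 0` and `B' = r a` on an open interval where `A > 0`, then `B / A` is nondecreasing
iff `B ≤ r A`. -/
lemma monotoneOn_div_iff_of_hasDerivAt {A B a r : ℝ → ℝ} {u v : ℝ}
    (hA : ∀ t ∈ Ioo u v, HasDerivAt A (a t) t)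
    (hB : ∀ t ∈ Ioo u v, HasDerivAt B (r t * a t) t)
    (ha : ∀ t ∈ Ioo u v, 0 < a t) (hApos : ∀ t ∈ Ioo u v, 0 < A t) :
    MonotoneOn (fun t => B t / A t) (Ioo u v) ↔ ∀ t ∈ Ioo u v, 0 ≤ r t * A t - B t := by
  have hd : ∀ t ∈ Ioo u v, HasDerivAt (fun t => B t / A t)
      (a t * (r t * A t - B t) / A t ^ 2) t := by
    intro t ht
    exact ((hB t ht).div (hA t ht) (hApos t ht).ne').congr_deriv (by ring)
  constructor
  · intro hm t ht
    have h0 : 0 ≤ derivWithin (fun t => B t / A t) (Ioo u v) t := hm.derivWithin_nonneg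
    rw [derivWithin_of_isOpen isOpen_Ioo ht, (hd t ht).deriv, le_div_iff₀ (pow_pos (hApos t ht) 2),
      zero_mul] at h0
    exact nonneg_of_mul_nonneg_right h0 (ha t ht)
  · intro h
    refine monotoneOn_of_deriv_nonneg (convex_Ioo u v)
      (fun t ht => (hd t ht).continuousAt.continuousWithinAt)
      (fun t ht => (hd t (interior_subset ht)).differentiableAt.differentiableWithinAt)
      fun t ht => ?_
    have ht' := interior_subset ht
    rw [(hd t ht').deriv]
    exact div_nonneg (mul_nonneg (ha t ht').le (h t ht')) (sq_nonneg _)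

theorem stmt15
    (φ ψ φ' ψ' r : ℝ → ℝ)
    (hφd : ∀ p ∈ Ioo (0:ℝ) 1, HasDerivAt φ (φ' p) p)
    (hψd : ∀ p ∈ Ioo (0:ℝ) 1, HasDerivAt ψ (ψ' p) p)
    (hφ'pos : ∀ p ∈ Ioo (0:ℝ) 1, 0 < φ' p)
    (hψ'pos : ∀ p ∈ Ioo (0:ℝ) 1, 0 < ψ' p)
    (hr : ∀ p ∈ Ioo (0:ℝ) 1, r p = ψ' p / φ' p)
    (hrc : ContinuousOn r (Ioo 0 1))
    (hφint : IntervalIntegrable φ volume 0 1)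
    (hψint : IntervalIntegrable ψ volume 0 1)
    (hφ'int : IntervalIntegrable (fun q => q * φ' q) volume 0 1)
    (hψ'int : IntervalIntegrable (fun q => q * ψ' q) volume 0 1)
    (EX EY : ℝ)
    (hEX : EX = ∫ q in (0:ℝ)..1, φ q) (hEY : EY = ∫ q in (0:ℝ)..1, ψ q)
    (pstar : ℝ) (hpstar : pstar ∈ Ioo (0:ℝ) 1)
    (hrup : MonotoneOn r (Ioo 0 pstar))
    (hrdown : AntitoneOn r (Ioo pstar 1))
    (L : EReal)
    (hL : Tendsto (fun t => ((r t * (φ t - EX) - (ψ t - EY) : ℝ) : EReal))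
      (𝓝[<] (1:ℝ)) (𝓝 L)) :
    MonotoneOn (fun t => (∫ q in (0:ℝ)..t, q * ψ' q) / (∫ q in (0:ℝ)..t, q * φ' q)) (Ioo 0 1) ↔ 0 ≤ L := by
  have h0 : (0:ℝ) ∈ Icc (0:ℝ) 1 := left_mem_Icc.2 zero_le_one
  have hψ'eq : ∀ q ∈ Ioo (0:ℝ) 1, q * ψ' q = r q * (q * φ' q) := by
    intro q hq
    have := (hφ'pos q hq).ne'
    rw [hr q hq]
    field_simp
  have hwpos : ∀ q ∈ Ioo (0:ℝ) 1, 0 < q * φ' q := fun q hq => mul_pos hq.1 (hφ'pos q hq)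
  have hrpos : ∀ q ∈ Ioo (0:ℝ) 1, 0 < r q := fun q hq => by
    rw [hr q hq]
    exact div_pos (hψ'pos q hq) (hφ'pos q hq)
  have hAd := fun t (ht : t ∈ Ioo (0:ℝ) 1) => hasDerivAt_integral_id_mul hφd hφint hφ'int ht
  have hBd := fun t (ht : t ∈ Ioo (0:ℝ) 1) => hasDerivAt_integral_id_mul hψd hψint hψ'int ht
  have hAlim := tendsto_integral_id_mul_sub hφd hφint hφ'int
  have hBlim := tendsto_integral_id_mul_sub hψd hψint hψ'int
  rw [← hEX] at hAlim
  rw [← hEY] at hBlim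
  have hApos : ∀ t ∈ Ioo (0:ℝ) 1, 0 < ∫ q in (0:ℝ)..t, q * φ' q := fun t ht =>
    intervalIntegral_pos_of_pos_on
      (intervalIntegrable_sub_of_mem_Icc hφ'int h0 (Ioo_subset_Icc_self ht))
      (fun q hq => hwpos q ⟨hq.1, hq.2.trans ht.2⟩) ht.1
  have hAadd : ∀ s ∈ Ioo (0:ℝ) 1, ∀ t ∈ Ioo (0:ℝ) 1, (∫ q in (0:ℝ)..s, q * φ' q) +
      ∫ q in s..t, q * φ' q = ∫ q in (0:ℝ)..t, q * φ' q := fun s hs t ht =>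
    integral_add_adjacent_intervals
      (intervalIntegrable_sub_of_mem_Icc hφ'int h0 (Ioo_subset_Icc_self hs))
      (intervalIntegrable_sub_of_mem_Icc hφ'int (Ioo_subset_Icc_self hs) (Ioo_subset_Icc_self ht))
  have hBadd : ∀ s ∈ Ioo (0:ℝ) 1, ∀ t ∈ Ioo (0:ℝ) 1, (∫ q in (0:ℝ)..s, q * ψ' q) +
      ∫ q in s..t, q * ψ' q = ∫ q in (0:ℝ)..t, q * ψ' q := fun s hs t ht =>
    integral_add_adjacent_intervals
      (intervalIntegrable_sub_of_mem_Icc hψ'int h0 (Ioo_subset_Icc_self hs))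
      (intervalIntegrable_sub_of_mem_Icc hψ'int (Ioo_subset_Icc_self hs) (Ioo_subset_Icc_self ht))
  rw [monotoneOn_div_iff_of_hasDerivAt hAd
    (fun t ht => hψ'eq t ht ▸ hBd t ht) hwpos hApos]
  set A : ℝ → ℝ := fun t => ∫ q in (0:ℝ)..t, q * φ' q with hA
  set B : ℝ → ℝ := fun t => ∫ q in (0:ℝ)..t, q * ψ' q with hB
  change (∀ t ∈ Ioo (0:ℝ) 1, 0 ≤ r t * A t - B t) ↔ 0 ≤ L
  have hDlt : ∀ t ∈ Ioo (0:ℝ) pstar, 0 ≤ r t * A t - B t := by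
    intro t ht
    have ht1 : t ∈ Ioo (0:ℝ) 1 := ⟨ht.1, ht.2.trans hpstar.2⟩
    have hle : B t ≤ ∫ q in (0:ℝ)..t, r t * (q * φ' q) := by
      refine integral_mono_on_of_le_Ioo ht.1.le
        (intervalIntegrable_sub_of_mem_Icc hψ'int h0 (Ioo_subset_Icc_self ht1))
        ((intervalIntegrable_sub_of_mem_Icc hφ'int h0 (Ioo_subset_Icc_self ht1)).const_mul _)
        fun q hq => ?_
      have hq1 : q ∈ Ioo (0:ℝ) 1 := ⟨hq.1, hq.2.trans ht1.2⟩
      rw [hψ'eq q hq1]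
      exact mul_le_mul_of_nonneg_right (hrup ⟨hq.1, hq.2.trans ht.2⟩ ht hq.2.le) (hwpos q hq1).le
    rw [intervalIntegral.integral_const_mul] at hle
    exact sub_nonneg.2 hle
  have hDstar : 0 ≤ r pstar * A pstar - B pstar := by
    have hc : Tendsto (fun t => r t * A t - B t) (𝓝[<] pstar)
        (𝓝 (r pstar * A pstar - B pstar)) :=
      (((hrc.continuousAt (isOpen_Ioo.mem_nhds hpstar)).mul (hAd _ hpstar).continuousAt).sub
        (hBd _ hpstar).continuousAt).tendsto.mono_left nhdsWithin_le_nhds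
    refine ge_of_tendsto hc ?_
    filter_upwards [Ioo_mem_nhdsLT hpstar.1] with t ht using hDlt t ht
  have hDanti : AntitoneOn (fun t => r t * A t - B t) (Ioo pstar 1) := by
    intro s hs t ht hst
    have hs1 : s ∈ Ioo (0:ℝ) 1 := ⟨hpstar.1.trans hs.1, hs.2⟩
    have ht1 : t ∈ Ioo (0:ℝ) 1 := ⟨hpstar.1.trans ht.1, ht.2⟩
    have hs' := Ioo_subset_Icc_self hs1
    have ht' := Ioo_subset_Icc_self ht1
    have hle : ∫ q in s..t, r t * (q * φ' q) ≤ ∫ q in s..t, q * ψ' q := by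
      refine integral_mono_on_of_le_Ioo hst
        ((intervalIntegrable_sub_of_mem_Icc hφ'int hs' ht').const_mul _)
        (intervalIntegrable_sub_of_mem_Icc hψ'int hs' ht') fun q hq => ?_
      have hq1 : q ∈ Ioo (0:ℝ) 1 := ⟨hs1.1.trans hq.1, hq.2.trans ht1.2⟩
      rw [hψ'eq q hq1]
      exact mul_le_mul_of_nonneg_right
        (hrdown ⟨hs.1.trans hq.1, hq.2.trans ht.2⟩ ht hq.2.le) (hwpos q hq1).le
    rw [intervalIntegral.integral_const_mul] at hle
    have h1 : A s + ∫ q in s..t, q * φ' q = A t := hAadd s hs1 t ht1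
    have h2 : B s + ∫ q in s..t, q * ψ' q = B t := hBadd s hs1 t ht1
    have h3 : r t * A s ≤ r s * A s :=
      mul_le_mul_of_nonneg_right (hrdown hs ht hst) (hApos s hs1).le
    change r t * A t - B t ≤ r s * A s - B s
    rw [← h1, ← h2]
    linarith
  -- The bracket in the criterion differs from `r A - B` by a term that vanishes at `1`.
  set e : ℝ → ℝ := fun t => r t * (φ t - EX - A t) - (ψ t - EY - B t) with he
  have he0 : Tendsto e (𝓝[<] (1:ℝ)) (𝓝 0) := by
    obtain ⟨m, hm⟩ := exists_between hpstar.2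
    have hbdd : IsBoundedUnder (· ≤ ·) (𝓝[<] (1:ℝ)) (norm ∘ r) := by
      refine ⟨r m, eventually_map.2 ?_⟩
      filter_upwards [Ioo_mem_nhdsLT hm.2] with t ht
      have hpos := hrpos t ⟨(hpstar.1.trans hm.1).trans ht.1, ht.2⟩
      simp only [Function.comp, Real.norm_eq_abs, abs_of_pos hpos]
      exact hrdown hm ⟨hm.1.trans ht.1, ht.2⟩ ht.1.le
    simpa using (isBoundedUnder_le_mul_tendsto_zero hbdd hAlim).sub hBlim
  have heq : ∀ t, r t * (φ t - EX) - (ψ t - EY) = (r t * A t - B t) + e t := fun t => by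
    simp only [he]
    ring
  simp only [heq] at hL
  constructor
  · intro h
    have hc : Tendsto (fun t => ((e t : ℝ) : EReal)) (𝓝[<] (1:ℝ)) (𝓝 ((0:ℝ) : EReal)) :=
      (continuous_coe_real_ereal.tendsto 0).comp he0
    refine le_of_tendsto_of_tendsto hc hL ?_
    filter_upwards [Ioo_mem_nhdsLT (zero_lt_one (α := ℝ))] with t ht
    exact EReal.coe_le_coe_iff.2 (by linarith [h t ht])
  · intro h s hs
    rcases lt_trichotomy s pstar with hlt | rfl | hgt
    · exact hDlt s ⟨hs.1, hlt⟩
    · exact hDstar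
    · have hlim : Tendsto (fun t => (((r s * A s - B s) + e t : ℝ) : EReal)) (𝓝[<] (1:ℝ))
          (𝓝 ((r s * A s - B s : ℝ) : EReal)) := by
        have := he0.const_add (r s * A s - B s)
        rw [add_zero] at this
        exact (continuous_coe_real_ereal.tendsto _).comp this
      have hle : L ≤ ((r s * A s - B s : ℝ) : EReal) := by
        refine le_of_tendsto_of_tendsto hL hlim ?_
        filter_upwards [Ioo_mem_nhdsLT hs.2] with t ht
        have hst := hDanti ⟨hgt, hs.2⟩ ⟨hgt.trans ht.1, ht.2⟩ ht.1.le
        exact EReal.coe_le_coe_iff.2 (by simpa using hst)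
      exact EReal.coe_nonneg.1 (h.trans hle)
end

section
/- Let m ≥ 1 and 0 < p₁ < ⋯ < p_{2m} < 1; set p₀ := 0 and p_{2m+1} := 1, and assume r is nondecreasing on (p_{k−1}, p_k) for every odd k and nonincreasing on (p_{k−1}, p_k) for every even k, for 1 ≤ k ≤ 2m+1 (so the quantile density ratio has an even number n = 2m of modes, the last one occurring from decreasing to increasing). Then X ≤_dmrl Y — i.e., the function p ↦ (∫_p¹ (1−q)·ψ'(q) dq)/(∫_p¹ (1−q)·φ'(q) dq) is monotone nondecreasing on (0,1) — if and only if, for every i = 1,…,m, ∫_{p_{2i−1}}^1 (1−q)·( ψ'(q) − r(p_{2i−1})·φ'(q) ) dq ≥ 0. -/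
open Set Filter Topology MeasureTheory intervalIntegral

theorem intervalIntegral_nonneg_of_nonneg_on {f : ℝ → ℝ} {a b : ℝ} (hab : a ≤ b)
    (hf : ∀ x ∈ Ioo a b, 0 ≤ f x) : 0 ≤ ∫ x in a..b, f x := by
  rw [integral_of_le hab, integral_Ioc_eq_integral_Ioo]
  exact setIntegral_nonneg measurableSet_Ioo hf

theorem IntervalIntegrable.of_mem_Icc {f : ℝ → ℝ} {a b s t : ℝ}
    (hf : IntervalIntegrable f volume a b) (hs : s ∈ Icc a b) (ht : t ∈ Icc a b) :
    IntervalIntegrable f volume s t :=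
  hf.mono_set (uIcc_subset_uIcc (Icc_subset_uIcc hs) (Icc_subset_uIcc ht))

theorem MonotoneOn.Icc_of_Ioo {f : ℝ → ℝ} {a b : ℝ} (hab : a < b) (hf : MonotoneOn f (Ioo a b))
    (hc : ContinuousOn f (Icc a b)) : MonotoneOn f (Icc a b) := by
  have key : ∀ x ∈ Icc a b, ClusterPt x (𝓟 (Ioo a b)) := fun x hx => by
    rwa [← mem_closure_iff_clusterPt, closure_Ioo hab.ne]
  have ha : a ∈ Icc a b := left_mem_Icc.2 hab.le
  have hb : b ∈ Icc a b := right_mem_Icc.2 hab.le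
  have h1 := hf.insert_of_continuousWithinAt (key a ha) ((hc a ha).mono Ioo_subset_Icc_self)
  rw [Ioo_insert_left hab] at h1
  have h2 := h1.insert_of_continuousWithinAt
    ((key b hb).mono (principal_mono.2 Ioo_subset_Ico_self)) ((hc b hb).mono Ico_subset_Icc_self)
  rwa [Ico_insert_right hab.le] at h2

theorem AntitoneOn.Icc_of_Ioo {f : ℝ → ℝ} {a b : ℝ} (hab : a < b) (hf : AntitoneOn f (Ioo a b))
    (hc : ContinuousOn f (Icc a b)) : AntitoneOn f (Icc a b) := by
  have h := MonotoneOn.Icc_of_Ioo hab hf.neg hc.neg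
  intro x hx y hy hxy
  simpa using h hx hy hxy

section TailIntegrals

variable {w v r : ℝ → ℝ}

theorem tailIntegral_pos (hw : IntervalIntegrable w volume 0 1) (hw0 : ∀ q ∈ Ioo (0 : ℝ) 1, 0 < w q)
    {s : ℝ} (hs : s ∈ Ioo (0 : ℝ) 1) : 0 < ∫ q in s..1, w q :=
  intervalIntegral_pos_of_pos_on (hw.of_mem_Icc ⟨hs.1.le, hs.2.le⟩ ⟨zero_le_one, le_rfl⟩)
    (fun x hx => hw0 x ⟨hs.1.trans hx.1, hx.2⟩) hs.2

theorem tailIntegral_sub_mul (hw : IntervalIntegrable w volume 0 1)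
    (hv : IntervalIntegrable v volume 0 1) (c : ℝ) {s t : ℝ} (hs : s ∈ Icc (0 : ℝ) 1)
    (ht : t ∈ Icc (0 : ℝ) 1) :
    ∫ q in s..t, (v q - c * w q) = (∫ q in s..t, v q) - c * ∫ q in s..t, w q := by
  rw [integral_sub (hv.of_mem_Icc hs ht) ((hw.of_mem_Icc hs ht).const_mul c),
    intervalIntegral.integral_const_mul]

theorem tailIntegral_sub_mul_split (hw : IntervalIntegrable w volume 0 1)
    (hv : IntervalIntegrable v volume 0 1) (c : ℝ) {s t : ℝ} (hs : s ∈ Icc (0 : ℝ) 1)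
    (ht : t ∈ Icc (0 : ℝ) 1) :
    (∫ q in s..t, (v q - c * w q)) + ∫ q in t..1, (v q - c * w q) =
      ∫ q in s..1, (v q - c * w q) := by
  have h := hv.sub (hw.const_mul c)
  exact integral_add_adjacent_intervals (h.of_mem_Icc hs ht)
    (h.of_mem_Icc ht ⟨zero_le_one, le_rfl⟩)

/-- The ratio of tail integrals of `v = r * w` and `w` is nondecreasing exactly when it dominates
`r` pointwise. -/
theorem monotoneOn_tailRatio_iff (hw : IntervalIntegrable w volume 0 1)
    (hv : IntervalIntegrable v volume 0 1) (hw0 : ∀ q ∈ Ioo (0 : ℝ) 1, 0 < w q)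
    (hvr : ∀ q ∈ Ioo (0 : ℝ) 1, v q = r q * w q) (hrc : ContinuousOn r (Ioo 0 1)) :
    MonotoneOn (fun t => (∫ q in t..(1 : ℝ), v q) / ∫ q in t..(1 : ℝ), w q) (Ioo 0 1) ↔
      ∀ s ∈ Ioo (0 : ℝ) 1, 0 ≤ ∫ q in s..1, (v q - r s * w q) := by
  have one_mem : (1 : ℝ) ∈ Icc (0 : ℝ) 1 := ⟨zero_le_one, le_rfl⟩
  constructor
  · intro hmono s hs
    by_contra! hneg
    rw [tailIntegral_sub_mul hw hv _ (Ioo_subset_Icc_self hs) one_mem] at hneg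
    have hA := tailIntegral_pos hw hw0 hs
    set c := (∫ q in s..1, v q) / ∫ q in s..1, w q with hc
    have hcr : c < r s := by rw [hc, div_lt_iff₀ hA]; linarith
    have hev : ∀ᶠ x in 𝓝 s, c < r x ∧ x ∈ Ioo (0 : ℝ) 1 :=
      ((hrc.continuousAt (isOpen_Ioo.mem_nhds hs)).eventually_const_lt hcr).and
        (isOpen_Ioo.mem_nhds hs)
    obtain ⟨ε, hε, hball⟩ := Metric.eventually_nhds_iff.1 hev
    have hst : ∀ x, s ≤ x → x ≤ s + ε / 2 → c < r x ∧ x ∈ Ioo (0 : ℝ) 1 := fun x h1 h2 =>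
      hball (by rw [Real.dist_eq, abs_of_nonneg (by linarith)]; linarith)
    set t := s + ε / 2 with htdef
    have hst' : s < t := by linarith
    have ht : t ∈ Ioo (0 : ℝ) 1 := (hst t hst'.le le_rfl).2
    have hle := hmono hs ht hst'.le
    have hB := tailIntegral_pos hw hw0 ht
    have hpos : 0 < ∫ q in s..t, (v q - c * w q) := by
      refine intervalIntegral_pos_of_pos_on ((hv.sub (hw.const_mul c)).of_mem_Icc
        (Ioo_subset_Icc_self hs) (Ioo_subset_Icc_self ht)) (fun x hx => ?_) hst'
      obtain ⟨h1, h2⟩ := hst x hx.1.le hx.2.le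
      rw [hvr x h2, ← sub_mul]
      exact mul_pos (sub_pos.2 h1) (hw0 x h2)
    have hsplit := tailIntegral_sub_mul_split hw hv c (Ioo_subset_Icc_self hs)
      (Ioo_subset_Icc_self ht)
    rw [tailIntegral_sub_mul hw hv c (Ioo_subset_Icc_self hs) one_mem,
      tailIntegral_sub_mul hw hv c (Ioo_subset_Icc_self ht) one_mem] at hsplit
    have hcA : c * (∫ q in s..1, w q) = ∫ q in s..1, v q := div_mul_cancel₀ _ hA.ne'
    change c ≤ (∫ q in t..1, v q) / ∫ q in t..1, w q at hle
    rw [le_div_iff₀ hB] at hle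
    linarith
  · intro hD s hs t ht hst
    have hA := tailIntegral_pos hw hw0 hs
    have hB := tailIntegral_pos hw hw0 ht
    change (∫ q in s..1, v q) / (∫ q in s..1, w q) ≤ _
    set c := (∫ q in s..1, v q) / ∫ q in s..1, w q
    have hcA : c * (∫ q in s..1, w q) = ∫ q in s..1, v q := div_mul_cancel₀ _ hA.ne'
    rw [le_div_iff₀ hB, ← sub_nonneg,
      ← tailIntegral_sub_mul hw hv c (Ioo_subset_Icc_self ht) one_mem]
    by_contra! hneg
    have hsub : Icc s t ⊆ Ioo (0 : ℝ) 1 := fun x hx =>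
      ⟨hs.1.trans_le hx.1, hx.2.trans_lt ht.2⟩
    have hcont : ContinuousOn (fun x => ∫ q in x..1, (v q - c * w q)) (Icc s t) := by
      have hint : IntegrableOn (fun q => v q - c * w q) (uIcc 0 1) := by
        rw [uIcc_of_le zero_le_one, ← intervalIntegrable_iff_integrableOn_Icc_of_le zero_le_one]
        exact hv.sub (hw.const_mul c)
      refine (continuousOn_primitive_interval_left hint).mono fun x hx => ?_
      rw [uIcc_of_le zero_le_one]
      exact Ioo_subset_Icc_self (hsub hx)
    have hcomp : IsCompact (Icc s t ∩ (fun x => ∫ q in x..1, (v q - c * w q)) ⁻¹' Ici 0) :=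
      isCompact_Icc.of_isClosed_subset (hcont.preimage_isClosed_of_isClosed isClosed_Icc isClosed_Ici)
        inter_subset_left
    have hne : s ∈ Icc s t ∩ (fun x => ∫ q in x..1, (v q - c * w q)) ⁻¹' Ici 0 := by
      refine ⟨left_mem_Icc.2 hst, ?_⟩
      rw [mem_preimage, mem_Ici,
        tailIntegral_sub_mul hw hv c (Ioo_subset_Icc_self hs) one_mem, hcA, sub_self]
    obtain ⟨u, ⟨hu, hu0⟩, hmax⟩ := hcomp.exists_isGreatest ⟨s, hne⟩
    rw [mem_preimage, mem_Ici, ← tailIntegral_sub_mul_split hw hv c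
      (Ioo_subset_Icc_self (hsub hu)) (Ioo_subset_Icc_self ht)] at hu0
    have hnonneg : 0 ≤ ∫ q in u..t, -(v q - c * w q) := by
      refine intervalIntegral_nonneg_of_nonneg_on hu.2 fun x hx => ?_
      have hxI : x ∈ Icc s t := ⟨hu.1.trans hx.1.le, hx.2.le⟩
      have hx01 := hsub hxI
      have hGx : ∫ q in x..1, (v q - c * w q) < 0 := by
        by_contra! h
        exact absurd (hmax ⟨hxI, h⟩) (not_le.2 hx.1)
      have hDx := hD x hx01
      rw [tailIntegral_sub_mul hw hv _ (Ioo_subset_Icc_self hx01) one_mem] at hGx hDx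
      have hrx : r x < c := lt_of_mul_lt_mul_right (by linarith) (tailIntegral_pos hw hw0 hx01).le
      rw [hvr x hx01, ← sub_mul, ← neg_mul]
      exact mul_nonneg (by linarith) (hw0 x hx01).le
    rw [intervalIntegral.integral_neg] at hnonneg
    linarith

theorem tailIntegral_sub_mul_le_of_monotoneOn (hw : IntervalIntegrable w volume 0 1)
    (hv : IntervalIntegrable v volume 0 1) (hw0 : ∀ q ∈ Ioo (0 : ℝ) 1, 0 < w q)
    (hvr : ∀ q ∈ Ioo (0 : ℝ) 1, v q = r q * w q) {s t : ℝ} (hs : 0 < s) (hst : s ≤ t) (ht : t < 1)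
    (hr : MonotoneOn r (Icc s t)) :
    ∫ q in t..1, (v q - r t * w q) ≤ ∫ q in s..1, (v q - r s * w q) := by
  have one_mem : (1 : ℝ) ∈ Icc (0 : ℝ) 1 := ⟨zero_le_one, le_rfl⟩
  have hsI : s ∈ Icc (0 : ℝ) 1 := ⟨hs.le, (hst.trans_lt ht).le⟩
  have htI : t ∈ Icc (0 : ℝ) 1 := ⟨(hs.trans_le hst).le, ht.le⟩
  rw [← tailIntegral_sub_mul_split hw hv (r s) hsI htI, tailIntegral_sub_mul hw hv (r s) htI one_mem,
    tailIntegral_sub_mul hw hv (r t) htI one_mem]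
  have hrst := hr (left_mem_Icc.2 hst) (right_mem_Icc.2 hst) hst
  have hA := tailIntegral_pos hw hw0 ⟨hs.trans_le hst, ht⟩
  have hnonneg : 0 ≤ ∫ q in s..t, (v q - r s * w q) := by
    refine intervalIntegral_nonneg_of_nonneg_on hst fun x hx => ?_
    have hx01 : x ∈ Ioo (0 : ℝ) 1 := ⟨hs.trans hx.1, hx.2.trans ht⟩
    rw [hvr x hx01, ← sub_mul]
    exact mul_nonneg (sub_nonneg.2 (hr (left_mem_Icc.2 hst) (Ioo_subset_Icc_self hx) hx.1.le))
      (hw0 x hx01).le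
  linarith [mul_le_mul_of_nonneg_right hrst hA.le]

theorem tailIntegral_sub_mul_le_of_antitoneOn (hw : IntervalIntegrable w volume 0 1)
    (hv : IntervalIntegrable v volume 0 1) (hw0 : ∀ q ∈ Ioo (0 : ℝ) 1, 0 < w q)
    (hvr : ∀ q ∈ Ioo (0 : ℝ) 1, v q = r q * w q) {s t : ℝ} (hs : 0 < s) (hst : s ≤ t) (ht : t < 1)
    (hr : AntitoneOn r (Icc s t)) :
    ∫ q in s..1, (v q - r s * w q) ≤ ∫ q in t..1, (v q - r t * w q) := by
  have h := tailIntegral_sub_mul_le_of_monotoneOn (v := -v) (r := -r) hw hv.neg hw0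
    (fun q hq => by simp [hvr q hq]) hs hst ht hr.neg
  have e : ∀ x q, (-v) q - (-r) x * w q = -(v q - r x * w q) := fun x q => by
    simp only [Pi.neg_apply]; ring
  simp only [e, intervalIntegral.integral_neg] at h
  exact neg_le_neg_iff.1 h

theorem tailIntegral_sub_mul_nonneg_of_monotoneOn (hw0 : ∀ q ∈ Ioo (0 : ℝ) 1, 0 < w q)
    (hvr : ∀ q ∈ Ioo (0 : ℝ) 1, v q = r q * w q) {s : ℝ} (hs : s ∈ Ioo (0 : ℝ) 1)
    (hr : MonotoneOn r (Ico s 1)) : 0 ≤ ∫ q in s..1, (v q - r s * w q) := by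
  refine intervalIntegral_nonneg_of_nonneg_on hs.2.le fun x hx => ?_
  have hx01 : x ∈ Ioo (0 : ℝ) 1 := ⟨hs.1.trans hx.1, hx.2⟩
  rw [hvr x hx01, ← sub_mul]
  exact mul_nonneg (sub_nonneg.2 (hr (left_mem_Ico.2 hs.2) (Ioo_subset_Ico_self hx) hx.1.le))
    (hw0 x hx01).le

end TailIntegrals

theorem exists_mem_Ioc_succ {p : ℕ → ℝ} {x : ℝ} {n : ℕ} (h0 : p 0 < x) (hn : x ≤ p n) :
    ∃ k < n, x ∈ Ioc (p k) (p (k + 1)) := by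
  induction n with
  | zero => exact absurd hn (not_le.2 h0)
  | succ n ih =>
    rcases le_or_gt x (p n) with h | h
    · obtain ⟨k, hk, hx⟩ := ih h
      exact ⟨k, hk.trans n.lt_succ_self, hx⟩
    · exact ⟨n, n.lt_succ_self, h, hn⟩

theorem stmt16
    (φ ψ φ' ψ' r : ℝ → ℝ)
    (hφd : ∀ p ∈ Ioo (0:ℝ) 1, HasDerivAt φ (φ' p) p)
    (hψd : ∀ p ∈ Ioo (0:ℝ) 1, HasDerivAt ψ (ψ' p) p)
    (hφ'pos : ∀ p ∈ Ioo (0:ℝ) 1, 0 < φ' p)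
    (hψ'pos : ∀ p ∈ Ioo (0:ℝ) 1, 0 < ψ' p)
    (hr : ∀ p ∈ Ioo (0:ℝ) 1, r p = ψ' p / φ' p)
    (hrc : ContinuousOn r (Ioo 0 1))
    (hφ'int : IntervalIntegrable (fun q => (1-q) * φ' q) volume 0 1)
    (hψ'int : IntervalIntegrable (fun q => (1-q) * ψ' q) volume 0 1)
    (m : ℕ) (hm : 1 ≤ m) (p : ℕ → ℝ)
    (hp0 : p 0 = 0) (hplast : p (2*m+1) = 1)
    (hpmono : ∀ k ≤ 2*m, p k < p (k+1))
    (hodd : ∀ k, 1 ≤ k → k ≤ 2*m+1 → Odd k → MonotoneOn r (Ioo (p (k-1)) (p k)))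
    (heven : ∀ k, 1 ≤ k → k ≤ 2*m+1 → Even k → AntitoneOn r (Ioo (p (k-1)) (p k))) :
    MonotoneOn (fun t => (∫ q in t..(1:ℝ), (1-q) * ψ' q) / (∫ q in t..(1:ℝ), (1-q) * φ' q)) (Ioo 0 1) ↔
      (∀ i, 1 ≤ i → i ≤ m →
        0 ≤ ∫ q in (p (2*i-1))..(1:ℝ), (1-q) * (ψ' q - r (p (2*i-1)) * φ' q)) := by
  have hw0 : ∀ q ∈ Ioo (0 : ℝ) 1, 0 < (1 - q) * φ' q := fun q hq =>
    mul_pos (sub_pos.2 hq.2) (hφ'pos q hq)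
  have hvr : ∀ q ∈ Ioo (0 : ℝ) 1, (1 - q) * ψ' q = r q * ((1 - q) * φ' q) := fun q hq => by
    rw [hr q hq]
    field_simp [(hφ'pos q hq).ne']
  have hpmono' : StrictMonoOn p (Iic (2 * m + 1)) :=
    strictMonoOn_Iic_of_lt_succ fun k hk => hpmono k (Nat.lt_succ_iff.1 hk)
  have hpmem : ∀ k, 1 ≤ k → k ≤ 2 * m → p k ∈ Ioo (0 : ℝ) 1 := fun k h1 h2 => by
    constructor
    · rw [← hp0]
      exact hpmono' (mem_Iic.2 (Nat.zero_le _)) (mem_Iic.2 (by omega)) h1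
    · rw [← hplast]
      exact hpmono' (mem_Iic.2 (by omega)) (mem_Iic.2 le_rfl) (by omega)
  have hcongr : ∀ c q : ℝ, (1 - q) * (ψ' q - c * φ' q) = (1 - q) * ψ' q - c * ((1 - q) * φ' q) :=
    fun c q => by ring
  simp only [hcongr]
  rw [monotoneOn_tailRatio_iff hφ'int hψ'int hw0 hvr hrc]
  refine ⟨fun h i h1 h2 => h _ (hpmem _ (by omega) (by omega)), fun h s hs => ?_⟩
  obtain ⟨k, hk, hsk⟩ := exists_mem_Ioc_succ (hp0.trans_lt hs.1) (hs.2.le.trans_eq hplast.symm)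
  have hpk : p k < p (k + 1) := hpmono k (Nat.lt_succ_iff.1 hk)
  rcases Nat.even_or_odd' k with ⟨i, rfl | rfl⟩
  · have hmon : MonotoneOn r (Ioo (p (2 * i)) (p (2 * i + 1))) :=
      hodd (2 * i + 1) (by omega) (by omega) (odd_two_mul_add_one i)
    rcases (show i ≤ m by omega).eq_or_lt with rfl | him
    · rw [hplast] at hmon
      exact tailIntegral_sub_mul_nonneg_of_monotoneOn hw0 hvr hs
        (hmon.mono fun x hx => ⟨hsk.1.trans_le hx.1, hx.2⟩)
    · have hb := hpmem (2 * i + 1) (by omega) (by omega)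
      have hmon' : MonotoneOn r (Icc s (p (2 * i + 1))) := by
        rcases hsk.2.eq_or_lt with heq | hlt
        · rw [← heq, Icc_self]
          exact subsingleton_singleton.monotoneOn r
        · exact MonotoneOn.Icc_of_Ioo hlt (hmon.mono (Ioo_subset_Ioo_left hsk.1.le))
            (hrc.mono fun x hx => ⟨hs.1.trans_le hx.1, hx.2.trans_lt hb.2⟩)
      exact (h (i + 1) (by omega) (by omega)).trans
        (tailIntegral_sub_mul_le_of_monotoneOn hφ'int hψ'int hw0 hvr hs.1 hsk.2 hb.2 hmon')
  · have ha := hpmem (2 * i + 1) (by omega) (by omega)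
    have hb := hpmem (2 * i + 1 + 1) (by omega) (by omega)
    have hanti : AntitoneOn r (Icc (p (2 * i + 1)) (p (2 * i + 1 + 1))) :=
      (heven (2 * i + 1 + 1) (by omega) (by omega) ⟨i + 1, by omega⟩).Icc_of_Ioo hpk
        (hrc.mono fun x hx => ⟨ha.1.trans_le hx.1, hx.2.trans_lt hb.2⟩)
    exact (h (i + 1) (by omega) (by omega)).trans
      (tailIntegral_sub_mul_le_of_antitoneOn hφ'int hψ'int hw0 hvr ha.1 hsk.1.le hs.2
        (hanti.mono (Icc_subset_Icc_right hsk.2)))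
end
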